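/- Let b ∈ ℤ[i] be fourth-power-free with factorization b = i^{s_b}(1+i)^{t_b} p₁^{r₁}⋯p_M^{r_M} q₁²⋯q_N² (s_b, t_b ∈ {0,1,2,3}, r_i ∈ {1,3}, the p_i, q_j distinct primary primes), and let d = i^{s_d}(1+i)^{t_d} ∏_{v ∈ V_d} v (s_d, t_d ∈ {0,1}) be a square-free divisor of b. Let L_b^{(1)} be the (M+N)×(M+N) matrix over 𝔽₂ obtained by reducing the Laplacian L(G_b) modulo 2, and let 𝟙^{(d)} ∈ 𝔽₂^{M+N} be the vector with v-th entry 1 exactly when v ∣ d. Then C_d(ℚ(i)_v) ≠ ∅ for every odd prime v dividing b if and only if both: (1) deg^{(1,3)}(q) ≡ m_q t_b + n_q s_b (mod 2) for every q ∈ {q₁,…,q_N} dividing d; and (2) L_b^{(1)} · 𝟙^{(d)} = y for some y ∈ 𝔽₂^{M+N} satisfying: (i) y_p = m_p t_d + n_p s_d for every p ∈ {p₁,…,p_M} with p ∤ d; (ii) y_p = deg^{(2)}(p) + m_p(t_b + t_d) + n_p(s_b + s_d) for every p ∈ {p₁,…,p_M} with p ∣ d; (iii) y_q = m_q t_d + n_q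 s_d or y_q = deg^{(1,3)}(q) + m_q(t_b + t_d) + n_q(s_b + s_d) for every q ∈ {q₁,…,q_N} with q ∤ d; (iv) y_q = deg^{(1)}(q) + m_q t_d + n_q(s_d + 1) + ½(deg^{(1,3)}(q) + m_q t_b + n_q s_b) for every q ∈ {q₁,…,q_N} with q ∣ d, where the quantity deg^{(1,3)}(q) + m_q t_b + n_q s_b is computed in ℤ/4ℤ, is even by (1), and its half is taken in ℤ/2ℤ (all degree and m, n values in (i)–(iv) reduced mod 2). -/

import Mathlib

open IsDedekindDomain

noncomputable section

/-- The element `i` of the Gaussian integers `ℤ[i]`. -/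
def ii : GaussianInt := ⟨0, 1⟩

/-- The element `1 + i` of `ℤ[i]`. -/
def tt : GaussianInt := 1 + ii

/-- A Gaussian integer is *primary* if it is `≡ 1 (mod (1+i)³)`. -/
def IsPrimary (α : GaussianInt) : Prop := tt ^ 3 ∣ (α - 1)

/-- A Gaussian integer `b` is *fourth-power-free* if no fourth power of a prime divides it. -/
def FourthPowerFree (b : GaussianInt) : Prop := ∀ p : GaussianInt, Prime p → ¬ p ^ 4 ∣ b

/-- `HasLocalPoint b d π` says that the homogeneous space `C_d : d·w² = d² − 4·b·z⁴` has a
point in the completion `ℚ(i)_π` of `ℚ(i)` at the prime `π`, i.e. either the affine equation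
`d·w² = d² − 4·b·z⁴` has a solution there, or `b/d` is a square there (the two points at
infinity are rational).  This is the meaning of `C_d(ℚ(i)_π) ≠ ∅`. -/
def HasLocalPoint (b d π : GaussianInt) : Prop :=
  ∀ v : HeightOneSpectrum GaussianInt, v.asIdeal = Ideal.span {π} →
    (∃ z w : v.adicCompletion (FractionRing GaussianInt),
        algebraMap GaussianInt _ d * w ^ 2
          = (algebraMap GaussianInt _ d) ^ 2 - 4 * algebraMap GaussianInt _ b * z ^ 4)
    ∨ (∃ u : v.adicCompletion (FractionRing GaussianInt),
        u ^ 2 * algebraMap GaussianInt _ d = algebraMap GaussianInt _ b)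

/-- The natural reduction `ℤ/4ℤ → ℤ/2ℤ`. -/
def c2 : ZMod 4 →+* ZMod 2 := ZMod.castHom (show (2:ℕ) ∣ 4 by norm_num) (ZMod 2)

variable {M N : ℕ}

/-- Partial out-degree: the sum `Σ_{w ∈ S} e(v→w)` of edge weights from `v` into a set `S`
of vertices, an element of `ℤ/4ℤ`. -/
def degSub (E : (Fin M ⊕ Fin N) → (Fin M ⊕ Fin N) → ZMod 4)
    (S : Finset (Fin M ⊕ Fin N)) (v : Fin M ⊕ Fin N) : ZMod 4 :=
  ∑ w ∈ S, E v w

/-- `deg^{(k)}(v)` for `k ∈ {1,3}`: sum of edge weights from `v` to vertices `p_i` with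
`r_i = k`. -/
def degP (E : (Fin M ⊕ Fin N) → (Fin M ⊕ Fin N) → ZMod 4) (r : Fin M → ℕ) (k : ℕ)
    (v : Fin M ⊕ Fin N) : ZMod 4 :=
  degSub E ((Finset.univ.filter fun i => r i = k).image Sum.inl) v

/-- `deg^{(2)}(v)`: sum of edge weights from `v` to the vertices `q_j`. -/
def degQ (E : (Fin M ⊕ Fin N) → (Fin M ⊕ Fin N) → ZMod 4) (v : Fin M ⊕ Fin N) : ZMod 4 :=
  degSub E (Finset.univ.image Sum.inr) v

/-- `deg^{(1,3)}(v) = deg^{(1)}(v) + deg^{(3)}(v)`. -/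
def degP13 (E : (Fin M ⊕ Fin N) → (Fin M ⊕ Fin N) → ZMod 4) (r : Fin M → ℕ)
    (v : Fin M ⊕ Fin N) : ZMod 4 :=
  degP E r 1 v + degP E r 3 v

/-- The mod-2 Laplacian `L_b^{(1)}` of the weighted graph `G_b`:
`L(G_b) = diag(deg(v)) − A(G_b)` over `ℤ/4ℤ`, reduced modulo 2. -/
def Lap1 (E : (Fin M ⊕ Fin N) → (Fin M ⊕ Fin N) → ZMod 4) :
    Matrix (Fin M ⊕ Fin N) (Fin M ⊕ Fin N) (ZMod 2) :=
  fun v w => c2 ((if v = w then degSub E Finset.univ v else 0) - E v w)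

/-- The indicator vector `𝟙^{(d)}` of the set of prime divisors of `d`. -/
def indVec (Vd : Finset (Fin M ⊕ Fin N)) : (Fin M ⊕ Fin N) → ZMod 2 :=
  fun v => if v ∈ Vd then 1 else 0

/-- The residues `x` with `x` and `J * x` both represented in `(0, p/2)`. -/
def quarterSystem (p : ℕ) [NeZero p] (J : ZMod p) : Finset (ZMod p) :=
  {x | 0 < x.valMinAbs ∧ 0 < (J * x).valMinAbs}

lemma valMinAbs_eq_of_abs_lt {p : ℕ} [NeZero p] {x : ZMod p} {n : ℤ} (h : (n : ZMod p) = x)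
    (h1 : -(p : ℤ) < 2 * n) (h2 : 2 * n < p) : x.valMinAbs = n :=
  (ZMod.valMinAbs_spec x n).2 ⟨h.symm, by constructor <;> linarith⟩

lemma valMinAbs_bounds {p : ℕ} [NeZero p] (hp : Odd p) (x : ZMod p) :
    -(p : ℤ) < 2 * x.valMinAbs ∧ 2 * x.valMinAbs < p := by
  obtain ⟨k, rfl⟩ := hp
  have := x.valMinAbs_mem_Ioc
  rw [Set.mem_Ioc] at this
  push_cast at *
  omega

lemma valMinAbs_neg_of_odd {p : ℕ} [NeZero p] (hp : Odd p) (x : ZMod p) :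
    (-x).valMinAbs = -x.valMinAbs := by
  have := valMinAbs_bounds hp x
  apply valMinAbs_eq_of_abs_lt <;> [simp; omega; omega]

section Gauss

variable {p : ℕ} [hp : Fact p.Prime] {J : ZMod p}

lemma card_quarterSystem (h2 : Odd p) (hJ : J ^ 2 = -1) :
    4 * (quarterSystem p J).card = p - 1 := by
  classical
  have hneg := valMinAbs_neg_of_odd h2
  have hJJ : ∀ x, J * (J * x) = -x := fun x => by linear_combination x * hJ
  have hJ0 : J ≠ 0 := by
    rintro rfl
    simp at hJ
  set S := quarterSystem p J with hS
  have hinj : Function.Injective (fun x : ZMod p => J * x) := mul_right_injective₀ hJ0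
  set T1 := S.image (fun x => J * x)
  set T2 := T1.image (fun x => J * x)
  set T3 := T2.image (fun x => J * x)
  have c1 : T1.card = S.card := Finset.card_image_of_injective _ hinj
  have c2 : T2.card = S.card := (Finset.card_image_of_injective _ hinj).trans c1
  have c3 : T3.card = S.card := (Finset.card_image_of_injective _ hinj).trans c2
  have m0 : ∀ x, x ∈ S ↔ 0 < x.valMinAbs ∧ 0 < (J * x).valMinAbs := by
    intro x; simp [hS, quarterSystem]
  have mi : ∀ (U : Finset (ZMod p)) (x : ZMod p), x ∈ U.image (fun x => J * x) ↔ -(J * x) ∈ U := by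
    intro U x
    rw [Finset.mem_image]
    constructor
    · rintro ⟨y, hy, rfl⟩
      rwa [hJJ, neg_neg]
    · intro h
      exact ⟨_, h, by rw [mul_neg, hJJ, neg_neg]⟩
  have m1 : ∀ x, x ∈ T1 ↔ (J * x).valMinAbs < 0 ∧ 0 < x.valMinAbs := by
    intro x; rw [mi, m0, mul_neg, hJJ, neg_neg, hneg]; simp
  have m2 : ∀ x, x ∈ T2 ↔ x.valMinAbs < 0 ∧ (J * x).valMinAbs < 0 := by
    intro x; rw [mi, m1, mul_neg, hJJ, neg_neg, hneg]; simp
  have m3 : ∀ x, x ∈ T3 ↔ 0 < (J * x).valMinAbs ∧ x.valMinAbs < 0 := by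
    intro x; rw [mi, m2, mul_neg, hJJ, neg_neg, hneg]; simp
  have hU : (Finset.univ.erase (0 : ZMod p)) = (S ∪ T1) ∪ (T2 ∪ T3) := by
    ext x
    simp only [Finset.mem_erase, Finset.mem_univ, and_true, Finset.mem_union, m0, m1, m2, m3]
    constructor
    · intro hx
      have a1 : x.valMinAbs ≠ 0 := by simpa using hx
      have a2 : (J * x).valMinAbs ≠ 0 := by simp [hx, hJ0]
      omega
    · rintro h rfl
      simp at h
  have hc : (Finset.univ.erase (0 : ZMod p)).card = p - 1 := by
    rw [Finset.card_erase_of_mem (Finset.mem_univ _), Finset.card_univ, ZMod.card]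
  rw [← hc, hU, Finset.card_union_of_disjoint, Finset.card_union_of_disjoint,
    Finset.card_union_of_disjoint, c1, c2, c3]
  · ring
  all_goals
    rw [Finset.disjoint_left]
    intro x
    simp only [Finset.mem_union, m0, m1, m2, m3]
    omega

open Finset in
lemma one_sub_pow_card_quarterSystem (h2 : Odd p) (hJ : J ^ 2 = -1) :
    (1 - J) ^ (quarterSystem p J).card =
      (-J) ^ (((quarterSystem p J).filter fun x => (J * x).valMinAbs < x.valMinAbs).card
        + 2 * (quarterSystem p J).card) := by
  classical
  have hneg := valMinAbs_neg_of_odd h2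
  have hbd := valMinAbs_bounds h2
  have hJJ : ∀ x, J * (J * x) = -x := fun x => by linear_combination x * hJ
  have hJ0 : J ≠ 0 := by
    rintro rfl
    simp at hJ
  have h20 : (2 : ZMod p) ≠ 0 := by
    intro h
    have : p ∣ 2 := (ZMod.natCast_eq_zero_iff 2 p).1 (by exact_mod_cast h)
    have h3 := Nat.le_of_dvd (by norm_num) this
    have := hp.out.two_le
    obtain ⟨k, hk⟩ := h2
    omega
  have hJ1 : J - 1 ≠ 0 := by
    intro h
    apply h20
    linear_combination hJ - (J + 1) * h
  have hJ4 : J ^ 4 = 1 := by linear_combination (J ^ 2 - 1) * hJ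
  set S := quarterSystem p J with hS
  have m0 : ∀ x, x ∈ S ↔ 0 < x.valMinAbs ∧ 0 < (J * x).valMinAbs := by
    intro x; simp [hS, quarterSystem]
  let k : ZMod p → ℕ := fun x =>
    if 2 * (x.valMinAbs + (J * x).valMinAbs) < p then
      if (J * x).valMinAbs < x.valMinAbs then 0 else 1
    else if (J * x).valMinAbs < x.valMinAbs then 3 else 2
  let σ : ZMod p → ZMod p := fun x => J ^ k x * ((1 - J) * x)
  have hne : ∀ x ∈ S, (J * x).valMinAbs ≠ x.valMinAbs := by
    intro x hx h
    have hx0 : x ≠ 0 := by rintro rfl; simp [m0] at hx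
    have := ZMod.injective_valMinAbs h
    exact hJ1 (mul_right_cancel₀ hx0 (by linear_combination this))
  -- the permutation induced by multiplication by `1 - J`
  have key : ∀ x ∈ S, σ x ∈ S ∧ ((J * σ x).valMinAbs < (σ x).valMinAbs ↔ k x = 1 ∨ k x = 3) := by
    intro x hx
    have hne := hne x hx
    rw [m0] at hx
    obtain ⟨hX, hY⟩ := hx
    obtain ⟨-, bX⟩ := hbd x
    obtain ⟨-, bY⟩ := hbd (J * x)
    have cX : ((x.valMinAbs : ℤ) : ZMod p) = x := ZMod.coe_valMinAbs x
    have cY : (((J * x).valMinAbs : ℤ) : ZMod p) = J * x := ZMod.coe_valMinAbs _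
    have hodd : 2 * (x.valMinAbs + (J * x).valMinAbs) ≠ p := by
      obtain ⟨q, hq⟩ := h2
      omega
    set X := x.valMinAbs with hXd
    set Y := (J * x).valMinAbs with hYd
    have hcx : ((1 - J) * x).valMinAbs = X - Y := by
      apply valMinAbs_eq_of_abs_lt
      · push_cast; rw [cX, cY]; ring
      · omega
      · omega
    have hJc : J * ((1 - J) * x) = x + J * x := by linear_combination (-x) * hJ
    rw [m0]
    by_cases h1 : 2 * (X + Y) < p
    · have hs : (J * ((1 - J) * x)).valMinAbs = X + Y := by
        apply valMinAbs_eq_of_abs_lt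
        · push_cast; rw [cX, cY, hJc]
        · omega
        · omega
      by_cases h3 : Y < X
      · have hk : k x = 0 := by simp only [k]; rw [if_pos h1, if_pos h3]
        simp only [σ, hk, pow_zero, one_mul, hcx, hs]
        omega
      · have hk : k x = 1 := by simp only [k]; rw [if_pos h1, if_neg h3]
        simp only [σ, hk, pow_one, hJJ, hneg, hcx, hs]
        exact ⟨by omega, iff_of_true (by omega) (by simp)⟩
    · have hs : (J * ((1 - J) * x)).valMinAbs = X + Y - p := by
        apply valMinAbs_eq_of_abs_lt
        · push_cast; rw [cX, cY, hJc]; simp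
        · omega
        · omega
      by_cases h3 : Y < X
      · have hk : k x = 3 := by simp only [k]; rw [if_neg h1, if_pos h3]
        have h33 : J ^ 3 * ((1 - J) * x) = -(J * ((1 - J) * x)) := by
          linear_combination J * ((1 - J) * x) * hJ
        simp only [σ, hk, h33, mul_neg, hJJ, neg_neg, hneg, hcx, hs]
        exact ⟨by omega, iff_of_true (by omega) (by simp)⟩
      · have hk : k x = 2 := by simp only [k]; rw [if_neg h1, if_neg h3]
        have h33 : J ^ 2 * ((1 - J) * x) = -((1 - J) * x) := by
          linear_combination ((1 - J) * x) * hJ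
        simp only [σ, hk, h33, mul_neg, hneg, hcx, hs]
        omega
  have hk4 : ∀ x, k x < 4 := by
    intro x
    simp only [k]
    split_ifs <;> norm_num
  have huniq : ∀ n : ℕ, ∀ x ∈ S, J ^ n * x ∈ S → J ^ n * x = x := by
    intro n x hx hx'
    rw [← Nat.div_add_mod n 4, pow_add, pow_mul, hJ4, one_pow, one_mul] at hx' ⊢
    have hn := Nat.mod_lt n (show 0 < 4 by norm_num)
    rw [m0] at hx hx'
    generalize n % 4 = r at *
    interval_cases r
    · simp
    · rw [pow_one, hJJ, hneg] at hx'; omega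
    · rw [hJ, neg_one_mul, hneg] at hx'; omega
    · have h33 : J ^ 3 * x = -(J * x) := by linear_combination J * x * hJ
      rw [h33, hneg] at hx'; omega
  have hinj : Set.InjOn σ S := by
    intro x hx y hy hxy
    have hc : (1 - J) ≠ 0 := by
      intro h; apply hJ1; linear_combination -h
    have h1 : J ^ k x * x = J ^ k y * y := by
      apply mul_left_cancel₀ hc
      simp only [σ] at hxy
      linear_combination hxy
    have h2 : J ^ (4 - k y + k x) * x = y := by
      rw [pow_add, mul_assoc, h1, ← mul_assoc, ← pow_add, Nat.sub_add_cancel (hk4 y).le, hJ4,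
        one_mul]
    rw [← h2]
    exact (huniq _ x hx (by rw [h2]; exact hy)).symm
  have himg : S.image σ = S := by
    apply Finset.eq_of_subset_of_card_le
    · intro y hy
      obtain ⟨x, hx, rfl⟩ := Finset.mem_image.1 hy
      exact (key x hx).1
    · rw [Finset.card_image_of_injOn hinj]
  have hprod : ∏ x ∈ S, σ x = ∏ x ∈ S, x := by
    conv_rhs => rw [← himg]
    rw [Finset.prod_image hinj]
  have hP0 : ∏ x ∈ S, x ≠ 0 := by
    rw [Finset.prod_ne_zero_iff]
    rintro x hx rfl
    simp [m0] at hx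
  have hfin : J ^ (∑ x ∈ S, k x) * (1 - J) ^ S.card = 1 := by
    apply mul_right_cancel₀ hP0
    rw [one_mul]
    conv_rhs => rw [← hprod]
    simp only [σ]
    rw [Finset.prod_mul_distrib, Finset.prod_mul_distrib, Finset.prod_pow_eq_pow_sum,
      Finset.prod_const, mul_assoc]
  -- counting
  have hL : (S.filter fun x => (J * x).valMinAbs < x.valMinAbs).card =
      (S.filter fun x => k x = 1 ∨ k x = 3).card := by
    conv_lhs => rw [← himg]
    rw [Finset.filter_image, Finset.card_image_of_injOn (hinj.mono (Finset.coe_subset.2 (Finset.filter_subset _ _)))]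
    congr 1
    exact Finset.filter_congr fun x hx => (key x hx).2
  have hL' : (S.filter fun x => (J * x).valMinAbs < x.valMinAbs).card =
      (S.filter fun x => k x = 0 ∨ k x = 3).card := by
    congr 1
    refine Finset.filter_congr fun x hx => ?_
    simp only [k]
    split_ifs <;> simp [*]
  have e1 : ∑ x ∈ S, k x + 2 * (S.filter fun x => k x = 1 ∨ k x = 3).card
      + 2 * (S.filter fun x => k x = 0 ∨ k x = 3).card
      = (S.filter fun x => k x = 1 ∨ k x = 3).card + 2 * S.card
        + 4 * (S.filter fun x => k x = 3).card := by
    simp only [Finset.card_filter, Finset.card_eq_sum_ones S, Finset.mul_sum]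
    simp only [← Finset.sum_add_distrib]
    refine Finset.sum_congr rfl fun x _ => ?_
    have := hk4 x
    generalize k x = r at *
    interval_cases r <;> simp
  rw [← hL, ← hL'] at e1
  set l := (S.filter fun x => (J * x).valMinAbs < x.valMinAbs).card
  have hneg4 : (-J) ^ 4 = 1 := by linear_combination (J ^ 2 - 1) * hJ
  have hmul : (-J) ^ (∑ x ∈ S, k x) * J ^ (∑ x ∈ S, k x) = 1 := by
    rw [← mul_pow, show -J * J = 1 by linear_combination -hJ, one_pow]
  calc (1 - J) ^ S.card = (-J) ^ (∑ x ∈ S, k x) * (J ^ (∑ x ∈ S, k x) * (1 - J) ^ S.card) := by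
        rw [← mul_assoc, hmul, one_mul]
    _ = (-J) ^ (∑ x ∈ S, k x) := by rw [hfin, mul_one]
    _ = (-J) ^ (∑ x ∈ S, k x + 4 * l) := by rw [pow_add, pow_mul (-J) 4, hneg4, one_pow, mul_one]
    _ = (-J) ^ (l + 2 * S.card + 4 * (S.filter fun x => k x = 3).card) := by
        congr 1; omega
    _ = _ := by rw [pow_add, pow_mul (-J) 4, hneg4, one_pow, mul_one]

end Gauss

section Counting

open Finset

lemma card_filter_eq_add_three {ι : Type*} (s : Finset ι) {P A B C : ι → Prop} [DecidablePred P]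
    [DecidablePred A] [DecidablePred B] [DecidablePred C]
    (h : ∀ x, P x ↔ A x ∨ B x ∨ C x) (hAB : ∀ x, A x → ¬ B x) (hAC : ∀ x, A x → ¬ C x)
    (hBC : ∀ x, B x → ¬ C x) :
    (s.filter P).card = (s.filter A).card + (s.filter B).card + (s.filter C).card := by
  simp only [card_filter, ← sum_add_distrib]
  refine sum_congr rfl fun x _ => ?_
  have := h x
  have := hAB x
  have := hAC x
  have := hBC x
  by_cases A x <;> by_cases B x <;> by_cases C x <;> simp_all

lemma two_mul_card_triangle (n : ℕ) (s : Finset (ℤ × ℤ))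
    (hs : ∀ x y, (x, y) ∈ s ↔ 0 < y ∧ y ≤ x ∧ x ≤ n) :
    2 * s.card = n * (n + 1) := by
  have : s.card = ((range (n + 1)).sigma fun x => range x).card := by
    refine card_nbij' (fun z => ⟨z.1.toNat, z.2.toNat - 1⟩) (fun z => ((z.1 : ℤ), (z.2 : ℤ) + 1))
      ?_ ?_ ?_ ?_
    · rintro ⟨x, y⟩ h
      rw [mem_coe, hs] at h
      simp
      omega
    · rintro ⟨x, y⟩ h
      rw [mem_coe, mem_sigma, mem_range, mem_range] at h
      rw [mem_coe, hs]
      dsimp only at *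
      omega
    · rintro ⟨x, y⟩ h
      rw [mem_coe, hs] at h
      ext <;> simp <;> omega
    · rintro ⟨x, y⟩ h
      simp
  rw [this, card_sigma]
  simp only [card_range]
  rw [mul_comm, sum_range_id_mul_two, mul_comm]
  simp

/-- Counting by rows in the `α × β` rectangle below the line of slope `2β / (2α + 1)`. -/
lemma card_below_line_mod_two (α β : ℕ) (hc : IsCoprime (2 * α + 1 : ℤ) β)
    (s : Finset (ℤ × ℤ))
    (hs : ∀ i j, (i, j) ∈ s ↔ 0 ≤ i ∧ 0 ≤ j ∧ 2 * i + 1 < 2 * α + 1 ∧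
      (2 * α + 1) * (2 * j + 1) < 2 * β * (2 * i + 1)) :
    (4 : ℤ) ∣ 2 * s.card - (2 * α * β + α * (α + 1)) := by
  set a : ℤ := 2 * α + 1 with ha
  have ha0 : 0 < a := by omega
  let n : ℕ → ℤ := fun i => (β * (2 * i + 1) + α) / a
  let ρ : ℕ → ℤ := fun i => β * (2 * i + 1) - a * n i
  have hρ : ∀ i, -(α : ℤ) ≤ ρ i ∧ ρ i ≤ α := by
    intro i
    have h1 := Int.emod_add_mul_ediv (β * (2 * i + 1) + α) a
    have h2 := Int.emod_nonneg (β * (2 * i + 1) + α) ha0.ne'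
    have h3 := Int.emod_lt_of_pos (β * (2 * i + 1) + α) ha0
    simp only [ρ, n]
    constructor <;> linarith
  have hn0 : ∀ i, 0 ≤ n i := fun i => Int.ediv_nonneg (by positivity) ha0.le
  have hcard : (s.card : ℤ) = ∑ i ∈ range α, n i := by
    have : s.card = ((range α).sigma fun i => range (n i).toNat).card := by
      have hkey : ∀ (i : ℕ) (j : ℤ), j < n i ↔ a * (2 * j + 1) < 2 * β * (2 * i + 1) := by
        intro i j
        rw [← Int.add_one_le_iff, Int.le_ediv_iff_mul_le ha0]
        have : (2 * β * (2 * i + 1) : ℤ) = 2 * (β * (2 * i + 1)) := by ring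
        rw [this]
        have : a * (2 * j + 1) = 2 * ((j + 1) * a) - a := by ring
        rw [this]
        generalize (β * (2 * i + 1) : ℤ) = u
        generalize (j + 1) * a = v
        omega
      refine card_nbij' (fun z => ⟨z.1.toNat, z.2.toNat⟩) (fun z => ((z.1 : ℤ), (z.2 : ℤ)))
        ?_ ?_ ?_ ?_
      · rintro ⟨x, y⟩ h
        rw [mem_coe, hs] at h
        obtain ⟨h1, h2, h3, h4⟩ := h
        lift x to ℕ using h1
        lift y to ℕ using h2
        rw [← hkey] at h4
        simp
        omega
      · rintro ⟨x, y⟩ h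
        rw [mem_coe, mem_sigma, mem_range, mem_range] at h
        rw [mem_coe, hs, ← hkey]
        dsimp only at *
        have := hn0 x
        omega
      · rintro ⟨x, y⟩ h
        rw [mem_coe, hs] at h
        ext <;> simp <;> omega
      · rintro ⟨x, y⟩ h
        simp
    rw [this, card_sigma]
    simp only [card_range]
    push_cast
    exact sum_congr rfl fun i _ => by have := hn0 i; omega
  have hdvd : ∀ z : ℤ, a ∣ β * z → a ∣ z := fun z h => hc.dvd_of_dvd_mul_left h
  have ha2 : IsCoprime a 2 := ⟨1, -α, by rw [ha]; ring⟩
  have hmaps : ∀ i ∈ range α, (ρ i).natAbs ∈ Icc 1 α := by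
    intro i hi
    rw [mem_range] at hi
    rw [mem_Icc]
    have := hρ i
    refine ⟨?_, by omega⟩
    by_contra h
    have h0 : ρ i = 0 := by omega
    have h1 : a ∣ 2 * i + 1 := hdvd _ ⟨n i, by simp only [ρ] at h0; linarith⟩
    have := Int.le_of_dvd (by omega) h1
    omega
  have hinj : Set.InjOn (fun i => (ρ i).natAbs) (range α : Finset ℕ) := by
    intro i hi k hk h
    rw [mem_coe, mem_range] at hi hk
    rcases Int.natAbs_eq_natAbs_iff.1 h with h | h
    · have h1 : a ∣ 2 * (i - k) := hdvd _ ⟨n i - n k, by simp only [ρ] at h; linarith⟩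
      have h2 := ha2.dvd_of_dvd_mul_left h1
      by_contra hne
      have := Int.natAbs_le_of_dvd_ne_zero h2 (by omega)
      omega
    · have h1 : a ∣ 2 * (i + k + 1) := hdvd _ ⟨n i + n k, by simp only [ρ] at h; linarith⟩
      have h2 := ha2.dvd_of_dvd_mul_left h1
      have := Int.le_of_dvd (by omega) h2
      omega
  have himg : (range α).image (fun i => (ρ i).natAbs) = Icc 1 α := by
    apply eq_of_subset_of_card_le
    · intro x hx
      obtain ⟨i, hi, rfl⟩ := mem_image.1 hx
      exact hmaps i hi
    · rw [card_image_of_injOn hinj]; simp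
  have hsum : 2 * ∑ i ∈ range α, ((ρ i).natAbs : ℤ) = α * (α + 1) := by
    have h1 : ∑ i ∈ range α, (ρ i).natAbs = ∑ x ∈ Icc 1 α, x := by
      rw [← himg, sum_image hinj]
    have h2 : ∑ x ∈ Icc 1 α, x = ∑ x ∈ range (α + 1), x := by
      refine sum_subset (fun x hx => ?_) (fun x hx hx' => ?_)
      · simp at hx ⊢
        omega
      · simp at hx hx'
        omega
    have h3 := sum_range_id_mul_two (α + 1)
    rw [← h2, ← h1] at h3
    zify at h3
    simp at h3
    push_cast
    linarith
  have hodd : ∑ i ∈ range α, (β * (2 * i + 1) : ℤ) = α * α * β := by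
    have : ∀ m : ℕ, ∑ i ∈ range m, (β * (2 * i + 1) : ℤ) = m * m * β := by
      intro m
      induction m with
      | zero => simp
      | succ k ih => rw [sum_range_succ, ih]; push_cast; ring
    exact this α
  have hpar : (2 : ℤ) ∣ ∑ i ∈ range α, n i - (α * β + ∑ i ∈ range α, ((ρ i).natAbs : ℤ)) := by
    have h1 : ∑ i ∈ range α, n i - (α * α * β + ∑ i ∈ range α, ((ρ i).natAbs : ℤ))
      = ∑ i ∈ range α, (n i - β * (2 * i + 1) - ((ρ i).natAbs : ℤ)) := by
      rw [sum_sub_distrib, sum_sub_distrib, hodd]; ring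
    have h2 : (2 : ℤ) ∣ ∑ i ∈ range α, (n i - β * (2 * i + 1) - ((ρ i).natAbs : ℤ)) := by
      refine dvd_sum fun i _ => ?_
      have : n i - β * (2 * i + 1) - ((ρ i).natAbs : ℤ)
        = - ρ i - ((ρ i).natAbs : ℤ) - 2 * (α * n i) := by
        simp only [ρ, ha]; ring
      rw [this]
      omega
    rw [← h1] at h2
    have h3 : (2 : ℤ) ∣ α * α * β - α * β := by
      have := (Int.even_mul_pred_self (α : ℤ)).two_dvd
      exact (this.mul_right (β : ℤ)).trans (dvd_of_eq (by ring))
    exact (dvd_add h2 h3).trans (dvd_of_eq (by ring))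
  rw [← hcard] at hpar
  have : 2 * (s.card : ℤ) - (2 * α * β + α * (α + 1)) =
    2 * (s.card - (α * β + ∑ i ∈ range α, ((ρ i).natAbs : ℤ))) := by rw [← hsum]; ring
  rw [this]
  exact mul_dvd_mul_left (2 : ℤ) hpar

end Counting

section Sector

open Finset

lemma card_eq_of_equiv_on {s t : Finset (ℤ × ℤ)} (f g : ℤ × ℤ → ℤ × ℤ)
    (hf : ∀ x y, (x, y) ∈ s → f (x, y) ∈ t ∧ g (f (x, y)) = (x, y))
    (hg : ∀ x y, (x, y) ∈ t → g (x, y) ∈ s ∧ f (g (x, y)) = (x, y)) : s.card = t.card :=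
  card_nbij' f g (fun z hz => (hf z.1 z.2 hz).1) (fun z hz => (hg z.1 z.2 hz).1)
    (fun z hz => (hf z.1 z.2 hz).2) (fun z hz => (hg z.1 z.2 hz).2)

lemma card_sector (α β : ℕ) (hβ : 0 < β) (hc : IsCoprime (2 * α + 1 : ℤ) (2 * β))
    (a b : ℤ) (ha : a = 2 * α + 1) (hb : b = 2 * β) (s : Finset (ℤ × ℤ))
    (hs : ∀ x y, (x, y) ∈ s ↔ 0 < a * y - b * x ∧ a * y - b * x < a * x + b * y ∧
      2 * (a * x + b * y) < a ^ 2 + b ^ 2) :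
    (8 : ℤ) ∣ 2 * s.card - (3 * (α * (α + 1)) + β * (β + 1) + 2 * α * β) := by
  rw [← ha, ← hb] at hc
  have ha0 : 0 < a := by omega
  have hb0 : 0 < b := by omega
  set box : Finset (ℤ × ℤ) := Icc (-(a + b)) (a + b) ×ˢ Icc (-(a + b)) (a + b) with hbox
  have mbox : ∀ (Q : ℤ × ℤ → Prop) [DecidablePred Q] (x y : ℤ),
      (Q (x, y) → -(a + b) ≤ x ∧ x ≤ a + b ∧ -(a + b) ≤ y ∧ y ≤ a + b) →
      ((x, y) ∈ box.filter Q ↔ Q (x, y)) := by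
    intro Q _ x y h
    rw [mem_filter, hbox, mem_product, mem_Icc, mem_Icc]
    dsimp only
    constructor
    · exact fun h => h.2
    · intro hQ
      have := h hQ
      exact ⟨by omega, hQ⟩
  let P : ℤ × ℤ → Prop := fun z => 0 < z.2 ∧ 2 * z.1 < a ∧ 2 * z.2 < a + b ∧
    a * z.2 - b * z.1 < a * z.1 + b * z.2
  let L : ℤ × ℤ → Prop := fun z => 0 < a * z.2 - b * z.1 ∧
    a * z.2 - b * z.1 < a * z.1 + b * z.2 ∧ 2 * (a * z.1 + b * z.2) < a ^ 2 + b ^ 2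
  let A : ℤ × ℤ → Prop := fun z => 0 < z.2 ∧ 2 * z.1 < a ∧ a * z.2 < b * z.1
  let B : ℤ × ℤ → Prop := fun z => 2 * z.1 < a ∧ 2 * z.2 < a + b ∧
    a ^ 2 + b ^ 2 < 2 * (a * z.1 + b * z.2)
  let C1 : ℤ × ℤ → Prop := fun z => 0 < z.2 ∧ z.2 ≤ z.1 ∧ 2 * z.1 < a
  let C2 : ℤ × ℤ → Prop := fun z => z.1 < z.2 ∧ a ≤ z.1 + z.2 ∧ 2 * z.1 < a ∧ 2 * z.2 < a + b
  let F : ℤ × ℤ → Prop := fun z => z.1 < z.2 ∧ z.1 + z.2 < a ∧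
    a * (z.2 - z.1) < b * (z.1 + z.2)
  let A' : ℤ × ℤ → Prop := fun z => 0 ≤ z.1 ∧ 0 ≤ z.2 ∧ 2 * z.1 + 1 < a ∧
    a * (2 * z.2 + 1) < b * (2 * z.1 + 1)
  let A'' : ℤ × ℤ → Prop := fun z => 0 ≤ z.1 ∧ 0 ≤ z.2 ∧ 2 * z.2 + 1 < b ∧
    b * (2 * z.1 + 1) < a * (2 * z.2 + 1)
  have hLb : ∀ x y, L (x, y) → 0 < y ∧ 2 * x < a ∧ 2 * y < a + b := by
    rintro x y ⟨h1, h2, h3⟩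
    dsimp only at h1 h2 h3
    have hp : 0 < a ^ 2 + b ^ 2 := by positivity
    refine ⟨?_, ?_, ?_⟩
    · refine pos_of_mul_pos_right (a := a ^ 2 + b ^ 2) ?_ hp.le
      nlinarith [mul_pos ha0 h1, mul_pos hb0 (h1.trans h2)]
    · refine lt_of_mul_lt_mul_left (a := a ^ 2 + b ^ 2) ?_ hp.le
      nlinarith [mul_pos hb0 h1, mul_pos ha0 (sub_pos.2 h3)]
    · refine lt_of_mul_lt_mul_left (a := a ^ 2 + b ^ 2) ?_ hp.le
      nlinarith [mul_pos ha0 (sub_pos.2 h2), mul_pos ha0 (sub_pos.2 h3),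
        mul_pos hb0 (sub_pos.2 h3)]
  have hBb : ∀ x y, B (x, y) → b < 2 * y ∧ b * x < a * y ∧
      a * y - b * x < a * x + b * y := by
    rintro x y ⟨h1, h2, h3⟩
    dsimp only at h1 h2 h3
    have e1 : b < 2 * y := by
      refine lt_of_mul_lt_mul_left (a := b) ?_ hb0.le
      nlinarith [mul_pos ha0 (sub_pos.2 h1)]
    refine ⟨e1, ?_, ?_⟩
    · nlinarith [mul_pos hb0 (sub_pos.2 h1), mul_pos ha0 (sub_pos.2 e1)]
    · refine lt_of_mul_lt_mul_left (a := 2 * a) ?_ (by omega)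
      have hp : 0 < a ^ 2 + b ^ 2 := by positivity
      nlinarith [mul_pos hp (sub_pos.2 h2), mul_pos ha0 (sub_pos.2 h3),
        mul_pos hb0 (sub_pos.2 h3)]
  have hAb : ∀ x y, A (x, y) → 0 < x ∧ 2 * y < b := by
    rintro x y ⟨h1, h2, h3⟩
    dsimp only at h1 h2 h3
    refine ⟨pos_of_mul_pos_right (a := b) ((mul_pos ha0 h1).trans h3) hb0.le, ?_⟩
    refine lt_of_mul_lt_mul_left (a := a) ?_ ha0.le
    nlinarith [mul_pos hb0 (sub_pos.2 h2)]
  have hPb : ∀ x y, P (x, y) → -y < x := by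
    rintro x y ⟨h1, h2, h3, h4⟩
    dsimp only at h1 h2 h3 h4
    refine lt_of_mul_lt_mul_left (a := a + b) ?_ (by omega)
    nlinarith [mul_pos hb0 h1]
  have hC2b : ∀ x y, C2 (x, y) → a * y - b * x < a * x + b * y := by
    rintro x y ⟨h1, h2, h3, h4⟩
    dsimp only at h1 h2 h3 h4
    have : y - x < b := by omega
    nlinarith [mul_pos ha0 (sub_pos.2 this), mul_nonneg hb0.le (sub_nonneg.2 h2)]
  have hFb : ∀ x y, F (x, y) → 0 < x + y ∧ y - x < b := by
    rintro x y ⟨h1, h2, h3⟩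
    dsimp only at h1 h2 h3
    constructor
    · refine pos_of_mul_pos_right (a := b)
        ((mul_pos ha0 (sub_pos.2 h1)).trans h3) hb0.le
    · refine lt_of_mul_lt_mul_left (a := a) ?_ ha0.le
      nlinarith [mul_pos hb0 (sub_pos.2 h2)]
  have hA'b : ∀ x y, A' (x, y) → 2 * y + 1 < b := by
    rintro x y ⟨h1, h2, h3, h4⟩
    dsimp only at h1 h2 h3 h4
    refine lt_of_mul_lt_mul_left (a := a) ?_ ha0.le
    nlinarith [mul_pos hb0 (sub_pos.2 h3)]
  have hA''b : ∀ x y, A'' (x, y) → 2 * x + 1 < a := by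
    rintro x y ⟨h1, h2, h3, h4⟩
    dsimp only at h1 h2 h3 h4
    refine lt_of_mul_lt_mul_left (a := b) ?_ hb0.le
    nlinarith [mul_pos ha0 (sub_pos.2 h3)]
  have eL : s.card = (box.filter L).card := by
    congr 1
    ext ⟨x, y⟩
    rw [hs, mbox]
    intro h
    have h1 := hLb x y h
    have h2 := hPb x y ⟨h1.1, h1.2.1, h1.2.2, h.2.1⟩
    omega
  have e1 : (box.filter P).card =
      (box.filter L).card + (box.filter A).card + (box.filter B).card := by
    apply card_filter_eq_add_three
    · rintro ⟨x, y⟩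
      constructor
      · intro h
        have h' := h
        obtain ⟨h1, h2, h3, h4⟩ := h
        dsimp only at h1 h2 h3 h4
        have hY : a * y - b * x ≠ 0 := by
          intro h0
          have hd : a ∣ x := by
            refine hc.dvd_of_dvd_mul_left ⟨y, by linarith⟩
          obtain ⟨k, rfl⟩ := hd
          have hy : y = b * k := mul_left_cancel₀ ha0.ne' (by linarith)
          subst hy
          have : 0 < k := pos_of_mul_pos_right h1 hb0.le
          nlinarith
        have hX : 2 * (a * x + b * y) ≠ a ^ 2 + b ^ 2 := by
          intro h0
          rw [ha, hb] at h0
          ring_nf at h0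
          omega
        rcases lt_or_gt_of_ne hY with h5 | h5
        · exact Or.inr (Or.inl ⟨h1, h2, by linarith⟩)
        · rcases lt_or_gt_of_ne hX with h6 | h6
          · exact Or.inl ⟨h5, h4, h6⟩
          · exact Or.inr (Or.inr ⟨h2, h3, h6⟩)
      · rintro (h | h | h)
        · have h1 := hLb x y h
          exact ⟨h1.1, h1.2.1, h1.2.2, h.2.1⟩
        · have h1 := hAb x y h
          refine ⟨h.1, h.2.1, by dsimp only; omega, ?_⟩
          have := h.2.2
          have := h.1
          dsimp only at *
          nlinarith [mul_pos ha0 h1.1, mul_pos hb0 this]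
        · have h1 := hBb x y h
          exact ⟨by dsimp only; omega, h.1, h.2.1, h1.2.2⟩
    · rintro ⟨x, y⟩ h h'
      have := h.1
      have := h'.2.2
      dsimp only at *
      linarith
    · rintro ⟨x, y⟩ h h'
      have := h.2.2
      have := h'.2.2
      dsimp only at *
      linarith
    · rintro ⟨x, y⟩ h h'
      have := h.2.2
      have := (hBb x y h').2.1
      dsimp only at *
      linarith
  have e2 : (box.filter P).card =
      (box.filter C1).card + (box.filter C2).card + (box.filter F).card := by
    apply card_filter_eq_add_three
    · rintro ⟨x, y⟩
      constructor
      · rintro ⟨h1, h2, h3, h4⟩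
        dsimp only at h1 h2 h3 h4
        by_cases h5 : y ≤ x
        · exact Or.inl ⟨h1, h5, h2⟩
        · by_cases h6 : a ≤ x + y
          · exact Or.inr (Or.inl ⟨not_le.1 h5, h6, h2, h3⟩)
          · exact Or.inr (Or.inr ⟨not_le.1 h5, not_le.1 h6, by dsimp only; linarith⟩)
      · rintro (h | h | h)
        · obtain ⟨h1, h2, h3⟩ := h
          dsimp only at h1 h2 h3
          refine ⟨h1, h3, by dsimp only; omega, ?_⟩
          dsimp only
          nlinarith [mul_nonneg ha0.le (sub_nonneg.2 h2), mul_pos hb0 h1]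
        · have h5 := hC2b x y h
          obtain ⟨h1, h2, h3, h4⟩ := h
          dsimp only at h1 h2 h3 h4
          exact ⟨by dsimp only; omega, h3, h4, h5⟩
        · have h5 := hFb x y h
          obtain ⟨h1, h2, h3⟩ := h
          dsimp only at h1 h2 h3
          exact ⟨by dsimp only; omega, by dsimp only; omega, by dsimp only; omega,
            by dsimp only; linarith⟩
    · rintro ⟨x, y⟩ h h'
      have := h.2.1
      have := h'.1
      dsimp only at *
      omega
    · rintro ⟨x, y⟩ h h'
      have := h.2.1
      have := h'.1
      dsimp only at *
      omega
    · rintro ⟨x, y⟩ h h'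
      have := h.2.1
      have := h'.2.1
      dsimp only at *
      omega
  have e3 : (box.filter F).card = (box.filter A).card + (box.filter A').card := by
    rw [← card_filter_add_card_filter_not (s := box.filter F) fun z => Even (z.1 + z.2)]
    have mF : ∀ x y, (x, y) ∈ box.filter F ↔ F (x, y) := by
      intro x y
      apply mbox
      intro h
      have h5 := hFb x y h
      obtain ⟨h1, h2, h3⟩ := h
      dsimp only at h1 h2 h3
      omega
    have mA : ∀ x y, (x, y) ∈ box.filter A ↔ A (x, y) := by
      intro x y
      apply mbox
      intro h
      have h5 := hAb x y h
      obtain ⟨h1, h2, h3⟩ := h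
      dsimp only at h1 h2 h3
      omega
    have mA' : ∀ x y, (x, y) ∈ box.filter A' ↔ A' (x, y) := by
      intro x y
      apply mbox
      intro h
      have h5 := hA'b x y h
      obtain ⟨h1, h2, h3⟩ := h
      dsimp only at h1 h2 h3
      omega
    congr 1
    · apply card_eq_of_equiv_on (fun z => ((z.1 + z.2) / 2, (z.2 - z.1) / 2))
        (fun z => (z.1 - z.2, z.1 + z.2))
      · intro x y h
        rw [mem_filter, mF] at h
        obtain ⟨⟨h1, h2, h3⟩, ⟨k, hk⟩⟩ := h
        dsimp only at h1 h2 h3 hk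
        obtain rfl : y = k + k - x := by omega
        rw [mA]
        dsimp only
        have g1 : (x + (k + k - x)) / 2 = k := by omega
        have g2 : (k + k - x - x) / 2 = k - x := by omega
        rw [g1, g2]
        refine ⟨⟨by dsimp only; omega, by dsimp only; omega, by dsimp only; linarith⟩, ?_⟩
        ext <;> simp <;> ring
      · intro x y h
        rw [mA] at h
        obtain ⟨h1, h2, h3⟩ := h
        dsimp only at h1 h2 h3
        rw [mem_filter, mF]
        dsimp only
        refine ⟨⟨⟨by dsimp only; omega, by dsimp only; omega, by dsimp only; linarith⟩, ?_⟩, ?_⟩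
        · exact ⟨x, by ring⟩
        · ext <;> dsimp only <;> omega
    · apply card_eq_of_equiv_on (fun z => ((z.1 + z.2) / 2, (z.2 - z.1) / 2))
        (fun z => (z.1 - z.2, z.1 + z.2 + 1))
      · intro x y h
        rw [mem_filter, mF, Int.not_even_iff_odd] at h
        obtain ⟨h', ⟨k, hk⟩⟩ := h
        have h5 := hFb _ _ h'
        obtain ⟨h1, h2, h3⟩ := h'
        dsimp only at h1 h2 h3 hk
        obtain rfl : y = 2 * k + 1 - x := by omega
        rw [mA']
        dsimp only
        have g1 : (x + (2 * k + 1 - x)) / 2 = k := by omega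
        have g2 : (2 * k + 1 - x - x) / 2 = k - x := by omega
        rw [g1, g2]
        refine ⟨⟨by dsimp only; omega, by dsimp only; omega, by dsimp only; omega,
          by dsimp only; linarith⟩, ?_⟩
        ext <;> simp <;> ring
      · intro x y h
        rw [mA'] at h
        obtain ⟨h1, h2, h3, h4⟩ := h
        dsimp only at h1 h2 h3 h4
        rw [mem_filter, mF, Int.not_even_iff_odd]
        dsimp only
        refine ⟨⟨⟨by dsimp only; omega, by dsimp only; omega, by dsimp only; linarith⟩, ?_⟩, ?_⟩
        · exact ⟨x, by ring⟩
        · ext <;> dsimp only <;> omega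
  have e4 : (box.filter B).card = (box.filter A'').card := by
    have mB : ∀ x y, (x, y) ∈ box.filter B ↔ B (x, y) := by
      intro x y
      apply mbox
      intro h
      have h5 := hBb x y h
      have := hPb x y ⟨by dsimp only; omega, h.1, h.2.1, h5.2.2⟩
      obtain ⟨h1, h2, h3⟩ := h
      dsimp only at h1 h2 h3
      omega
    have mA'' : ∀ x y, (x, y) ∈ box.filter A'' ↔ A'' (x, y) := by
      intro x y
      apply mbox
      intro h
      have h5 := hA''b x y h
      obtain ⟨h1, h2, h3⟩ := h
      dsimp only at h1 h2 h3
      omega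
    apply card_eq_of_equiv_on (fun z => (α + β - z.2, z.1 - 1 - α + β))
      (fun z => (z.2 + 1 + α - β, α + β - z.1))
    · intro x y h
      rw [mB] at h
      obtain ⟨h1, h2, h3⟩ := h
      dsimp only at h1 h2 h3
      have h4 : b * (2 * (α + β - y) + 1) < a * (2 * (x - 1 - α + β) + 1) := by
        have g1 : 2 * (α + β - y) + 1 = a + b - 2 * y := by omega
        have g2 : 2 * (x - 1 - α + β) + 1 = 2 * x - a + b := by omega
        rw [g1, g2]
        linarith
      have h5 : 0 ≤ α + β - y := by omega
      have h6 : 0 < 2 * (x - 1 - α + β) + 1 :=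
        pos_of_mul_pos_right (a := a) (lt_trans (by positivity) h4) ha0.le
      rw [mA'']
      refine ⟨⟨h5, by dsimp only; omega, by dsimp only; omega, h4⟩, ?_⟩
      ext <;> dsimp only <;> ring
    · intro x y h
      rw [mA''] at h
      obtain ⟨h1, h2, h3, h4⟩ := h
      dsimp only at h1 h2 h3 h4
      rw [mB]
      refine ⟨⟨by dsimp only; omega, by dsimp only; omega, ?_⟩, ?_⟩
      · dsimp only
        have g1 : 2 * (a * (y + 1 + α - β) + b * (α + β - x))
          = a * (2 * y + 1 + a - b) + b * (a - 1 + b - 2 * x) := by rw [ha, hb]; ring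
        rw [g1]
        linarith
      · ext <;> dsimp only <;> ring
  have e5 : (box.filter A').card + (box.filter A'').card = α * β := by
    have hR : ((Ico (0 : ℤ) α) ×ˢ (Ico (0 : ℤ) β)).card = α * β := by simp
    rw [← hR, ← card_filter_add_card_filter_not (s := (Ico (0 : ℤ) α) ×ˢ (Ico (0 : ℤ) β)) A']
    congr 2
    · ext ⟨x, y⟩
      rw [mbox, mem_filter, mem_product, mem_Ico, mem_Ico]
      · constructor
        · intro h
          have h5 := hA'b x y h
          refine ⟨?_, h⟩
          obtain ⟨h1, h2, h3, h4⟩ := h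
          dsimp only at *
          omega
        · exact fun h => h.2
      · intro h
        have h5 := hA'b x y h
        obtain ⟨h1, h2, h3⟩ := h
        dsimp only at h1 h2 h3
        omega
    · ext ⟨x, y⟩
      rw [mbox, mem_filter, mem_product, mem_Ico, mem_Ico]
      · constructor
        · intro h
          have h5 := hA''b x y h
          obtain ⟨h1, h2, h3, h4⟩ := h
          dsimp only at h1 h2 h3 h4
          refine ⟨by dsimp only; omega, fun h' => ?_⟩
          have := h'.2.2.2
          dsimp only at this
          linarith
        · rintro ⟨h1, h2⟩
          dsimp only at h1
          refine ⟨h1.1.1, h1.2.1, by dsimp only; omega, ?_⟩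
          by_contra h3
          dsimp only at h3
          rcases lt_or_eq_of_le (not_lt.1 h3) with h4 | h4
          · exact h2 ⟨h1.1.1, h1.2.1, by dsimp only; omega, h4⟩
          · have : a ∣ 2 * x + 1 := hc.dvd_of_dvd_mul_left ⟨_, h4.symm⟩
            have := Int.le_of_dvd (by omega) this
            omega
      · intro h
        have h5 := hA''b x y h
        obtain ⟨h1, h2, h3⟩ := h
        dsimp only at h1 h2 h3
        omega
  have e6 : 2 * (box.filter C1).card = α * (α + 1) := by
    apply two_mul_card_triangle
    intro x y
    rw [mbox]
    · constructor
      · rintro ⟨h1, h2, h3⟩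
        dsimp only at h1 h2 h3
        omega
      · rintro ⟨h1, h2, h3⟩
        exact ⟨h1, h2, by dsimp only; omega⟩
    · rintro ⟨h1, h2, h3⟩
      dsimp only at h1 h2 h3
      omega
  have e7 : 2 * (box.filter C2).card = β * (β + 1) := by
    have hinj : Function.Injective (fun z : ℤ × ℤ => (z.2 - (α : ℤ), (α : ℤ) - z.1 + 1)) := by
      rintro ⟨x, y⟩ ⟨x', y'⟩ h
      simp only [Prod.mk.injEq] at h ⊢
      omega
    rw [← card_image_of_injective _ hinj]
    apply two_mul_card_triangle
    intro x y
    rw [mem_image]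
    constructor
    · rintro ⟨⟨x', y'⟩, h, h'⟩
      rw [mem_filter] at h
      obtain ⟨h0, h1, h2, h3, h4⟩ := h
      simp only [Prod.mk.injEq] at h'
      dsimp only at h1 h2 h3 h4
      omega
    · intro h
      refine ⟨(α + 1 - y, x + α), ?_, ?_⟩
      · have hC : C2 (α + 1 - y, x + α) := by
          refine ⟨?_, ?_, ?_, ?_⟩ <;> dsimp only <;> omega
        rw [mbox]
        · exact hC
        · intro _
          omega
      · ext <;> dsimp only <;> ring
  have e8 := card_below_line_mod_two α β
    (by rw [← ha]; exact hc.of_isCoprime_of_dvd_right ⟨2, by rw [hb]; ring⟩)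
    (box.filter A') (by
      intro i j
      rw [mbox]
      · simp only [A', ha, hb]
      · intro h
        have h5 := hA'b i j h
        obtain ⟨h1, h2, h3⟩ := h
        dsimp only at h1 h2 h3
        omega)
  rw [eL]
  zify at e1 e2 e3 e4 e5 e6 e7
  obtain ⟨k, hk⟩ := e8
  refine ⟨k, ?_⟩
  linarith

end Sector

section TtSymbol

/-- The residue of `tt` to the power `(Nm π - 1) / 4` modulo `π` is the power of `ii` predicted
by the coordinates of `π`. -/
def TtSymbolFormula (π : GaussianInt) : Prop :=
  ∃ e : ℕ, (32 : ℤ) ∣ 8 * e - (1 - π.re ^ 2 + π.im ^ 2 + 2 * π.re * π.im + 8 * π.im) ∧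
    π ∣ tt ^ ((π.norm.natAbs - 1) / 4) - ii ^ e

lemma ii_sq : ii ^ 2 = -1 := by
  ext <;> simp [ii, pow_two]

lemma ii_pow_four : ii ^ 4 = 1 := by
  linear_combination (ii ^ 2 - 1) * ii_sq

lemma norm_natAbs_eq (π : GaussianInt) : (π.norm.natAbs : ℤ) = π.re ^ 2 + π.im ^ 2 := by
  rw [Int.natAbs_of_nonneg (GaussianInt.norm_nonneg π), Zsqrtd.norm_def]
  ring

lemma card_filter_quarterSystem {p : ℕ} [hp : Fact p.Prime] {J : ZMod p} (h2 : Odd p)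
    (α β : ℕ) (hβ : 0 < β) (a b : ℤ) (ha : a = 2 * α + 1) (hb : b = 2 * β)
    (hab : (p : ℤ) = a ^ 2 + b ^ 2) (hJa : J * a = -b) (hJb : J * b = a) :
    (8 : ℤ) ∣ 2 * ((quarterSystem p J).filter fun x => (J * x).valMinAbs < x.valMinAbs).card -
      (3 * (α * (α + 1)) + β * (β + 1) + 2 * α * β) := by
  classical
  have hp0 : (p : ℤ) ≠ 0 := by exact_mod_cast hp.out.ne_zero
  have hc : IsCoprime a b := by
    rw [Int.isCoprime_iff_gcd_eq_one]
    by_contra hg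
    obtain ⟨ℓ, hℓ, hd⟩ := Nat.exists_prime_and_dvd hg
    have h1 : (ℓ : ℤ) ∣ a := (Int.natCast_dvd_natCast.2 hd).trans (Int.gcd_dvd_left a b)
    have h2 : (ℓ : ℤ) ∣ b := (Int.natCast_dvd_natCast.2 hd).trans (Int.gcd_dvd_right a b)
    have h3 : ((ℓ ^ 2 : ℕ) : ℤ) ∣ p := by
      rw [hab]
      push_cast
      exact dvd_add (pow_dvd_pow_of_dvd h1 2) (pow_dvd_pow_of_dvd h2 2)
    rw [Int.natCast_dvd_natCast] at h3
    rcases (Nat.dvd_prime hp.out).1 h3 with h | h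
    · exact hℓ.one_lt.ne' (by simpa using h)
    · have := hp.out
      rw [← h] at this
      exact Nat.Prime.not_prime_pow le_rfl this
  set l := (quarterSystem p J).filter fun x => (J * x).valMinAbs < x.valMinAbs with hl
  have ml : ∀ x, x ∈ l ↔ 0 < (J * x).valMinAbs ∧ (J * x).valMinAbs < x.valMinAbs := by
    intro x
    rw [hl, Finset.mem_filter, quarterSystem, Finset.mem_filter]
    simp only [Finset.mem_univ, true_and]
    omega
  -- lattice coordinates
  let f : ZMod p → ℤ × ℤ := fun x =>
    ((a * x.valMinAbs - b * (J * x).valMinAbs) / p, (b * x.valMinAbs + a * (J * x).valMinAbs) / p)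
  have hf : ∀ x, p * (f x).1 = a * x.valMinAbs - b * (J * x).valMinAbs ∧
      p * (f x).2 = b * x.valMinAbs + a * (J * x).valMinAbs := by
    intro x
    constructor
    · apply Int.mul_ediv_cancel'
      rw [← ZMod.intCast_zmod_eq_zero_iff_dvd]
      push_cast
      linear_combination -x * hJb
    · apply Int.mul_ediv_cancel'
      rw [← ZMod.intCast_zmod_eq_zero_iff_dvd]
      push_cast
      linear_combination x * hJa
  have hf' : ∀ x, a * (f x).1 + b * (f x).2 = x.valMinAbs ∧
      a * (f x).2 - b * (f x).1 = (J * x).valMinAbs := by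
    intro x
    obtain ⟨h1, h2⟩ := hf x
    constructor
    · apply mul_left_cancel₀ hp0
      linear_combination a * h1 + b * h2 - x.valMinAbs * hab
    · apply mul_left_cancel₀ hp0
      linear_combination a * h2 - b * h1 - (J * x).valMinAbs * hab
  have hinj : Function.Injective f := by
    intro x y h
    apply ZMod.injective_valMinAbs
    rw [← (hf' x).1, ← (hf' y).1, h]
  rw [← Finset.card_image_of_injective l hinj]
  apply card_sector α β hβ (by rw [← ha, ← hb]; exact hc) a b ha hb
  intro x y
  rw [Finset.mem_image]
  constructor
  · rintro ⟨z, hz, hzf⟩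
    rw [ml] at hz
    have h1 := hf' z
    rw [hzf] at h1
    obtain ⟨h1, h2⟩ := h1
    dsimp only at h1 h2
    rw [h1, h2, ← hab]
    exact ⟨hz.1, hz.2, (valMinAbs_bounds (by assumption) z).2⟩
  · rintro ⟨h1, h2, h3⟩
    rw [← hab] at h3
    have g1 : ((a * x + b * y : ℤ) : ZMod p).valMinAbs = a * x + b * y :=
      valMinAbs_eq_of_abs_lt rfl (by omega) h3
    have g2 : (J * ((a * x + b * y : ℤ) : ZMod p)).valMinAbs = a * y - b * x := by
      apply valMinAbs_eq_of_abs_lt _ (by omega) (by omega)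
      push_cast
      linear_combination (-y) * hJb - x * hJa
    refine ⟨((a * x + b * y : ℤ) : ZMod p), ?_, ?_⟩
    · rw [ml, g1, g2]
      exact ⟨h1, h2⟩
    · obtain ⟨k1, k2⟩ := hf ((a * x + b * y : ℤ) : ZMod p)
      rw [g1, g2] at k1 k2
      ext
      · apply mul_left_cancel₀ hp0
        rw [k1, hab]; ring
      · apply mul_left_cancel₀ hp0
        rw [k2, hab]; ring

lemma dvd_of_residue_eq_zero {p : ℕ} {J : ZMod p} {π : GaussianInt} (hp : p ≠ 0)
    (hnorm : (p : ℤ) = π.re ^ 2 + π.im ^ 2) (hJa : J * π.re = -π.im) (hJb : J * π.im = π.re)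
    (w : GaussianInt) (hw : (w.re : ZMod p) - J * w.im = 0) : π ∣ w := by
  have hp0 : (p : ℤ) ≠ 0 := by exact_mod_cast hp
  have h1 : (p : ℤ) ∣ w.re * π.re + w.im * π.im := by
    rw [← ZMod.intCast_zmod_eq_zero_iff_dvd]
    push_cast
    linear_combination (π.re : ZMod p) * hw + (w.im : ZMod p) * hJa
  have h2 : (p : ℤ) ∣ w.im * π.re - w.re * π.im := by
    rw [← ZMod.intCast_zmod_eq_zero_iff_dvd]
    push_cast
    linear_combination (-(π.im : ZMod p)) * hw - (w.im : ZMod p) * hJb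
  obtain ⟨X, hX⟩ := h1
  obtain ⟨Y, hY⟩ := h2
  refine ⟨⟨X, Y⟩, ?_⟩
  ext
  · rw [Zsqrtd.re_mul]
    apply mul_left_cancel₀ hp0
    linear_combination w.re * hnorm + π.re * hX - π.im * hY
  · rw [Zsqrtd.im_mul]
    apply mul_left_cancel₀ hp0
    linear_combination w.im * hnorm + π.re * hY + π.im * hX

lemma ttSymbolFormula_of_pos {π : GaussianInt} (α β : ℕ) (hβ : 0 < β)
    (ha : π.re = 2 * α + 1) (hb : π.im = 2 * β) (hp : π.norm.natAbs.Prime) :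
    TtSymbolFormula π := by
  obtain ⟨p, hpN⟩ : ∃ p, p = π.norm.natAbs := ⟨_, rfl⟩
  rw [← hpN] at hp
  have hnorm : (p : ℤ) = π.re ^ 2 + π.im ^ 2 := by rw [hpN, norm_natAbs_eq]
  have : Fact p.Prime := ⟨hp⟩
  have h2 : Odd p := by
    rw [← Int.odd_coe_nat, hnorm, ha, hb]
    exact ⟨2 * α ^ 2 + 2 * α + 2 * β ^ 2, by ring⟩
  have hb0 : (π.im : ZMod p) ≠ 0 := by
    intro h
    rw [ZMod.intCast_zmod_eq_zero_iff_dvd] at h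
    have := Int.le_of_dvd (by omega) h
    nlinarith [sq_nonneg π.re]
  have hsq : (π.re : ZMod p) ^ 2 + (π.im : ZMod p) ^ 2 = 0 := by
    have : ((p : ℤ) : ZMod p) = ((π.re ^ 2 + π.im ^ 2 : ℤ) : ZMod p) := by rw [hnorm]
    push_cast at this
    rw [← this, ZMod.natCast_self]
  let J : ZMod p := π.re / π.im
  have hJb : J * π.im = π.re := by simp only [J]; field_simp
  have hJ : J ^ 2 = -1 := by
    simp only [J]; field_simp; linear_combination hsq
  have hJa : J * π.re = -π.im := by
    rw [← hJb]; linear_combination (π.im : ZMod p) * hJ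
  have c1 := card_quarterSystem h2 hJ
  have c2 := one_sub_pow_card_quarterSystem h2 hJ
  have c3 := card_filter_quarterSystem h2 α β hβ π.re π.im ha hb hnorm hJa hJb
  set l := ((quarterSystem p J).filter fun x => (J * x).valMinAbs < x.valMinAbs).card
  set S := (quarterSystem p J).card
  have hS : (p - 1) / 4 = S := by omega
  have hS' : (4 * S : ℤ) = π.re ^ 2 + π.im ^ 2 - 1 := by
    rw [← hnorm]
    have := hp.pos
    omega
  refine ⟨l + 2 * S, ?_, ?_⟩
  · obtain ⟨k, hk⟩ := c3
    obtain ⟨u, hu⟩ := (Int.even_mul_succ_self (α : ℤ)).two_dvd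
    obtain ⟨v, hv⟩ := (Int.even_mul_pred_self (β : ℤ)).two_dvd
    rw [ha, hb] at hS' ⊢
    refine ⟨k + 2 * u + v, ?_⟩
    push_cast
    linear_combination 4 * hk + 4 * hS' + 32 * hu + 16 * hv
  · rw [← hpN, hS]
    let φ : GaussianInt →+* ZMod p := Zsqrtd.lift ⟨-J, by push_cast; linear_combination hJ⟩
    have hφ : ∀ w : GaussianInt, φ w = w.re - J * w.im := by
      intro w
      simp only [φ, Zsqrtd.lift_apply_apply]
      ring
    apply dvd_of_residue_eq_zero hp.ne_zero hnorm hJa hJb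
    rw [← hφ, map_sub, map_pow, map_pow, hφ, hφ]
    simp only [tt, ii, Zsqrtd.re_add, Zsqrtd.im_add, Zsqrtd.re_one, Zsqrtd.im_one]
    push_cast
    rw [sub_eq_zero]
    simpa using c2

lemma TtSymbolFormula.neg {π : GaussianInt} (hb : (2 : ℤ) ∣ π.im) (h : TtSymbolFormula π) :
    TtSymbolFormula (-π) := by
  obtain ⟨e, h1, h2⟩ := h
  refine ⟨e, ?_, ?_⟩
  · obtain ⟨k, hk⟩ := h1
    obtain ⟨l, hl⟩ := hb
    refine ⟨k + l, ?_⟩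
    rw [Zsqrtd.re_neg, Zsqrtd.im_neg]
    linear_combination hk + 16 * hl
  · rw [Zsqrtd.norm_neg, neg_dvd]
    exact h2

lemma TtSymbolFormula.conj {π : GaussianInt} (ha : Odd π.re) (hb : (2 : ℤ) ∣ π.im)
    (h : TtSymbolFormula π) : TtSymbolFormula (star π) := by
  obtain ⟨e, h1, h2⟩ := h
  obtain ⟨α, hα⟩ := ha
  obtain ⟨β, hβ⟩ := hb
  have hN := norm_natAbs_eq π
  set k := (π.norm.natAbs - 1) / 4 with hk
  have hk4 : (4 * k : ℤ) = π.re ^ 2 + π.im ^ 2 - 1 := by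
    have : (π.norm.natAbs : ℤ) = 4 * (α ^ 2 + α + β ^ 2) + 1 := by rw [hN, hα, hβ]; ring
    rw [← hN]
    generalize (α ^ 2 + α + β ^ 2) = t at *
    omega
  refine ⟨3 * e + k, ?_, ?_⟩
  · obtain ⟨m, hm⟩ := h1
    rw [Zsqrtd.re_star, Zsqrtd.im_star]
    have : (2 : ℤ) ∣ β * (β + 2 * α + 1) := by
      rcases Int.even_or_odd' β with ⟨c, h | h⟩
      · exact ⟨c * (β + 2 * α + 1), by rw [h]; ring⟩
      · exact ⟨β * (c + α + 1), by rw [h]; ring⟩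
    obtain ⟨t, ht⟩ := this
    refine ⟨3 * m + t + 2 * β, ?_⟩
    push_cast
    rw [hα, hβ] at *
    linear_combination 3 * hm + 2 * hk4 + 16 * ht
  · rw [Zsqrtd.norm_conj, ← hk]
    have h3 : star π ∣ star (tt ^ k - ii ^ e) := by
      obtain ⟨c, hc⟩ := h2
      exact ⟨star c, by rw [hc, star_mul, mul_comm]⟩
    have h4 : ii ^ k * star (tt ^ k - ii ^ e) = tt ^ k - ii ^ (3 * e + k) := by
      have s1 : star ii = ii ^ 3 := by
        rw [pow_succ, ii_sq]; ext <;> simp [ii]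
      have s2 : star tt * ii = tt := by
        ext <;> simp [tt, ii]
      rw [star_sub, star_pow, star_pow, mul_sub, s1, ← mul_pow, mul_comm ii, s2, pow_add,
        pow_mul]
      ring
    rw [← h4]
    exact h3.mul_left _

lemma ttSymbolFormula_of_nat {ℓ : ℕ} (hℓ : ℓ.Prime) (h3 : ℓ % 4 = 3) :
    TtSymbolFormula (ℓ : GaussianInt) := by
  have : Fact ℓ.Prime := ⟨hℓ⟩
  obtain ⟨k, hk⟩ : ∃ k, ℓ = 4 * k + 3 := ⟨ℓ / 4, by omega⟩
  refine ⟨3 * (k + 1), ?_, ?_⟩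
  · rw [Zsqrtd.re_natCast, Zsqrtd.im_natCast, hk]
    obtain ⟨t, ht⟩ := (Int.even_mul_succ_self ((k : ℤ) + 1)).two_dvd
    refine ⟨t, ?_⟩
    push_cast
    linear_combination 16 * ht
  · have hN : ((ℓ : GaussianInt).norm.natAbs - 1) / 4 = (ℓ - 1) * (k + 1) := by
      rw [Zsqrtd.norm_natCast]
      have : ((ℓ : ℤ) * ℓ).natAbs = 4 * ((ℓ - 1) * (k + 1)) + 1 := by
        zify [hℓ.one_le]
        rw [abs_of_nonneg (by positivity), hk]
        push_cast
        ring
      rw [this]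
      omega
    rw [hN]
    obtain ⟨c, hc⟩ := exists_add_pow_prime_eq hℓ (1 : GaussianInt) ii
    have hiℓ : ii ^ ℓ = -ii := by
      rw [hk, pow_add, pow_mul, ii_pow_four, one_pow, one_mul, pow_succ, ii_sq]; ring
    have h5 : (ℓ : GaussianInt) ∣ tt ^ (ℓ - 1) - ii ^ 3 := by
      have h6 : tt ^ (ℓ - 1) * tt = tt ^ ℓ := by
        rw [← pow_succ, Nat.sub_add_cancel hℓ.one_le]
      have h7 : (ℓ : GaussianInt) ∣ (tt ^ (ℓ - 1) - ii ^ 3) * (tt * (1 - ii)) := by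
        refine ⟨c * (1 - ii) * ii, ?_⟩
        have h8 : tt ^ ℓ = 1 - ii + ℓ * ii * c := by
          rw [show tt = 1 + ii from rfl, hc, hiℓ]; ring
        have h9 : tt = 1 + ii := rfl
        linear_combination (1 - ii) * h6 + (1 - ii) * h8 - ii ^ 3 * (1 - ii) * h9
          + (1 - 2 * ii + ii ^ 3) * ii_sq
      have h8 : tt * (1 - ii) = 2 := by
        rw [show tt = 1 + ii from rfl]
        linear_combination -ii_sq
      rw [h8] at h7
      have h9 : IsCoprime (ℓ : GaussianInt) 2 :=
        ⟨1, -(2 * k + 1), by rw [hk]; push_cast; ring⟩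
      exact h9.dvd_of_dvd_mul_right h7
    rw [pow_mul, pow_mul]
    exact h5.trans (sub_dvd_pow_sub_pow _ _ _)

lemma ttSymbolFormula_of_prime {π : GaussianInt} (hπ : Prime π) (ha : Odd π.re)
    (hb : (2 : ℤ) ∣ π.im) : TtSymbolFormula π := by
  have hN := norm_natAbs_eq π
  -- `π` divides a rational prime
  obtain ⟨ℓ, hℓ, hd⟩ : ∃ ℓ : ℕ, ℓ.Prime ∧ π ∣ ℓ := by
    have h1 : π ∣ ((π.norm.natAbs : ℕ) : GaussianInt) := by
      refine ⟨star π, ?_⟩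
      rw [← Zsqrtd.norm_eq_mul_conj]
      have := Int.natAbs_of_nonneg (GaussianInt.norm_nonneg π)
      conv_rhs => rw [← this]
      exact (Int.cast_natCast _).symm
    have h0 : π.norm.natAbs ≠ 0 := by
      intro h
      rw [Int.natAbs_eq_zero, GaussianInt.norm_eq_zero] at h
      exact hπ.ne_zero h
    rw [← Nat.prod_primeFactorsList h0, Nat.cast_list_prod] at h1
    obtain ⟨x, hx, hx'⟩ := (hπ.dvd_prod_iff).1 h1
    obtain ⟨ℓ, hℓ, rfl⟩ := List.mem_map.1 hx
    exact ⟨ℓ, Nat.prime_of_mem_primeFactorsList hℓ, hx'⟩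
  obtain ⟨c, hc⟩ := hd
  have hcN := norm_natAbs_eq c
  have hprod : π.norm.natAbs * c.norm.natAbs = ℓ ^ 2 := by
    rw [← Int.natAbs_mul, ← Zsqrtd.norm_mul, ← hc, Zsqrtd.norm_natCast, Int.natAbs_mul,
      Int.natAbs_natCast, pow_two]
  have hN1 : π.norm.natAbs ≠ 1 := by
    intro h
    exact hπ.not_isUnit (Zsqrtd.norm_eq_one_iff.1 h)
  obtain ⟨j, hj, hjN⟩ := (Nat.dvd_prime_pow hℓ).1 (Dvd.intro _ hprod)
  interval_cases j
  · exact absurd (by simpa using hjN) hN1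
  · -- split prime
    rw [pow_one] at hjN
    have hpr : π.norm.natAbs.Prime := hjN ▸ hℓ
    have hb0 : π.im ≠ 0 := by
      intro h
      rw [h] at hN
      have h5 : π.norm.natAbs = π.re.natAbs ^ 2 := by
        apply Int.natCast_inj.1; rw [hN]; simp
      rw [h5] at hpr
      exact Nat.Prime.not_prime_pow le_rfl hpr
    have main : ∀ ρ : GaussianInt, ρ.re = |π.re| → ρ.im = |π.im| → ρ.norm.natAbs.Prime →
        TtSymbolFormula ρ := by
      intro ρ h1 h2 h3
      have := abs_pos.2 hb0
      have := abs_nonneg π.re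
      have h4 : Odd |π.re| := by rwa [odd_abs]
      have h5 : 2 ∣ |π.im| := by rwa [dvd_abs]
      obtain ⟨α, hα⟩ := h4
      obtain ⟨β, hβ⟩ := h5
      lift α to ℕ using by omega
      lift β to ℕ using by omega
      exact ttSymbolFormula_of_pos α β (by omega) (by omega) (by omega) h3
    have hodd' : ∀ x : ℤ, Odd x → Odd (-x) := fun x hx => hx.neg
    rcases le_total 0 π.re with h1 | h1 <;> rcases le_total 0 π.im with h2 | h2
    · exact main π (abs_of_nonneg h1).symm (abs_of_nonneg h2).symm hpr
    · have := main (star π) (by simp [abs_of_nonneg h1]) (by simp [abs_of_nonpos h2])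
        (by rwa [Zsqrtd.norm_conj])
      simpa using this.conj (by simpa using ha) (by simpa using hb)
    · have := main (-star π) (by simp [abs_of_nonpos h1]) (by simp [abs_of_nonneg h2])
        (by rwa [Zsqrtd.norm_neg, Zsqrtd.norm_conj])
      have := (this.neg (by simpa using hb)).conj (by simpa using ha) (by simpa using hb)
      simpa using this
    · have := main (-π) (by simp [abs_of_nonpos h1]) (by simp [abs_of_nonpos h2])
        (by rwa [Zsqrtd.norm_neg])
      simpa using this.neg (by simpa using hb)
  · -- inert prime
    have hc1 : c.norm.natAbs = 1 := by
      rw [hjN] at hprod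
      exact Nat.eq_of_mul_eq_mul_left (pow_pos hℓ.pos 2) (by rw [hprod, mul_one])
    rw [hc1] at hcN
    have him := congrArg Zsqrtd.im hc
    have hre := congrArg Zsqrtd.re hc
    rw [Zsqrtd.im_mul, Zsqrtd.im_natCast] at him
    rw [Zsqrtd.re_mul, Zsqrtd.re_natCast] at hre
    have hcim : c.im = 0 := by
      by_contra h
      have h1 : c.re = 0 := by
        by_contra h'
        have := Int.one_le_abs h
        have := Int.one_le_abs h'
        have := sq_abs c.re
        have := sq_abs c.im
        push_cast at hcN
        nlinarith
      rw [h1, mul_zero, add_zero] at him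
      have : π.re = 0 := by
        rcases mul_eq_zero.1 him.symm with h | h'
        · exact h
        · exact absurd h' h
      rw [this] at ha
      exact absurd ha (by decide)
    rw [hcim] at hcN him hre
    have hcre : c.re = 1 ∨ c.re = -1 := by
      push_cast at hcN
      have h1 : (c.re - 1) * (c.re + 1) = 0 := by linear_combination -hcN
      rcases mul_eq_zero.1 h1 with h | h
      · left; omega
      · right; omega
    have key : π = ℓ ∨ π = -ℓ := by
      rcases hcre with h | h <;> rw [h] at him hre
      · left; ext <;> simp <;> linarith
      · right; ext <;> simp <;> linarith
    have hPℓ : Prime (ℓ : GaussianInt) := by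
      rcases key with h | h
      · rwa [← h]
      · rw [← neg_neg (ℓ : GaussianInt), ← h]; exact hπ.neg
    have : Fact ℓ.Prime := ⟨hℓ⟩
    have h3 := GaussianInt.mod_four_eq_three_of_nat_prime_of_prime ℓ hPℓ
    have := ttSymbolFormula_of_nat hℓ h3
    rcases key with h | h
    · rwa [h]
    · rw [h]; exact this.neg (by simp)

end TtSymbol

section Supplement

lemma ii_pow_eq_of_modEq {a b : ℕ} (h : a ≡ b [MOD 4]) : ii ^ a = ii ^ b := by
  rw [← Nat.div_add_mod a 4, ← Nat.div_add_mod b 4, pow_add, pow_mul, pow_add, pow_mul,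
    ii_pow_four, one_pow, one_pow, h]

lemma formula_reference (m n : ZMod 4) :
    ∃ w : GaussianInt, (1 - 4 * ii) ^ m.val * (-1 - 6 * ii) ^ n.val = w ∧
    (32 : ℤ) ∣ 8 * m.val - (1 - w.re ^ 2 + w.im ^ 2 + 2 * w.re * w.im + 8 * w.im) ∧
    (16 : ℤ) ∣ w.re ^ 2 + w.im ^ 2 - (1 + 4 * n.val) ∧ w.re % 2 = 1 ∧ w.im % 2 = 0 := by
  have : ∀ m n : ZMod 4, ∀ w ∈ [(1 - 4 * (⟨0, 1⟩ : GaussianInt)) ^ m.val *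
      (-1 - 6 * ⟨0, 1⟩) ^ n.val],
      (32 : ℤ) ∣ 8 * m.val - (1 - w.re ^ 2 + w.im ^ 2 + 2 * w.re * w.im + 8 * w.im) ∧
      (16 : ℤ) ∣ w.re ^ 2 + w.im ^ 2 - (1 + 4 * n.val) ∧ w.re % 2 = 1 ∧ w.im % 2 = 0 := by
    decide +kernel
  exact ⟨_, rfl, this m n _ (List.mem_singleton.2 rfl)⟩

variable {π : GaussianInt} {m n : ZMod 4}

lemma coordinates_of_reference
    (h : tt ^ 7 ∣ π - (1 - 4 * ii) ^ m.val * (-1 - 6 * ii) ^ n.val) :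
    (32 : ℤ) ∣ 8 * m.val - (1 - π.re ^ 2 + π.im ^ 2 + 2 * π.re * π.im + 8 * π.im) ∧
    (16 : ℤ) ∣ π.re ^ 2 + π.im ^ 2 - (1 + 4 * n.val) ∧ Odd π.re ∧ 2 ∣ π.im := by
  obtain ⟨w, h0, hw⟩ := formula_reference m n
  rw [h0] at h
  obtain ⟨c, hc⟩ := h
  have h7 : tt ^ 7 = ⟨8, -8⟩ := by
    have : tt ^ 2 = ⟨0, 2⟩ := by ext <;> simp [tt, ii, pow_two]
    rw [show 7 = 2 * 3 + 1 from rfl, pow_succ, pow_mul, this]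
    ext <;> simp [tt, ii, pow_succ]
  rw [h7] at hc
  have hre : π.re = w.re + 8 * (c.re + c.im) := by
    have := congrArg Zsqrtd.re hc
    rw [Zsqrtd.re_sub, Zsqrtd.re_mul] at this
    linarith
  have him : π.im = w.im + 8 * (c.im - c.re) := by
    have := congrArg Zsqrtd.im hc
    rw [Zsqrtd.im_sub, Zsqrtd.im_mul] at this
    linarith
  obtain ⟨⟨k, hk⟩, ⟨l, hl⟩, ho, he⟩ := hw
  obtain ⟨y, hy⟩ := Int.dvd_of_emod_eq_zero he
  rw [hre, him]
  refine ⟨⟨k + w.re * c.re + 2 * (c.re + c.im) ^ 2 - 2 * (c.im - c.re) ^ 2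
    - 4 * (c.im ^ 2 - c.re ^ 2) - 2 * c.im * y - 2 * (c.im - c.re), ?_⟩,
    ⟨l + w.re * (c.re + c.im) + w.im * (c.im - c.re) + 4 * (c.re + c.im) ^ 2
      + 4 * (c.im - c.re) ^ 2, ?_⟩, ?_, ?_⟩
  · linear_combination hk - 32 * c.im * hy
  · linear_combination hl
  · rw [Int.odd_iff]; omega
  · omega

lemma four_dvd_norm_sub_one
    (h : tt ^ 7 ∣ π - (1 - 4 * ii) ^ m.val * (-1 - 6 * ii) ^ n.val) :
    4 ∣ π.norm.natAbs - 1 := by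
  obtain ⟨-, h2, -⟩ := coordinates_of_reference h
  rw [← norm_natAbs_eq] at h2
  omega

lemma dvd_ii_pow_sub
    (h : tt ^ 7 ∣ π - (1 - 4 * ii) ^ m.val * (-1 - 6 * ii) ^ n.val) :
    π ∣ ii ^ ((π.norm.natAbs - 1) / 4) - ii ^ n.val := by
  obtain ⟨-, h2, ho, -⟩ := coordinates_of_reference h
  rw [← norm_natAbs_eq] at h2
  rw [ii_pow_eq_of_modEq (b := n.val), sub_self]
  · exact dvd_zero _
  · have := norm_natAbs_eq π
    rw [Nat.ModEq]
    have hpos : 0 < π.norm.natAbs := by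
      by_contra h0
      have : (π.norm.natAbs : ℤ) = 0 := by omega
      omega
    omega

lemma dvd_tt_pow_sub (hπ : Prime π)
    (h : tt ^ 7 ∣ π - (1 - 4 * ii) ^ m.val * (-1 - 6 * ii) ^ n.val) :
    π ∣ tt ^ ((π.norm.natAbs - 1) / 4) - ii ^ m.val := by
  obtain ⟨h1, -, ho, he⟩ := coordinates_of_reference h
  obtain ⟨e, h3, h4⟩ := ttSymbolFormula_of_prime hπ ho he
  rw [ii_pow_eq_of_modEq (a := m.val) (b := e)]
  · exact h4
  · rw [Nat.ModEq]
    generalize 1 - π.re ^ 2 + π.im ^ 2 + 2 * π.re * π.im + 8 * π.im = t at *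
    omega

end Supplement

section Residue

/-- The coordinates of a Gaussian integer, as a `ℤ`-linear equivalence. -/
def coordEquiv : GaussianInt ≃ₗ[ℤ] (Fin 2 → ℤ) where
  toFun z := ![z.re, z.im]
  invFun f := ⟨f 0, f 1⟩
  map_add' x y := by ext i; fin_cases i <;> simp
  map_smul' n x := by ext i; fin_cases i <;> simp
  left_inv x := by simp
  right_inv f := by ext i; fin_cases i <;> simp

lemma card_quotient_span (π : GaussianInt) :
    Nat.card (GaussianInt ⧸ Ideal.span {π}) = π.norm.natAbs := by
  let B : Module.Basis (Fin 2) ℤ GaussianInt := Module.Basis.ofEquivFun coordEquiv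
  have : Module.Free ℤ GaussianInt := Module.Free.of_basis B
  have : Module.Finite ℤ GaussianInt := Module.Finite.of_basis B
  have h := Ideal.absNorm_span_singleton π
  rw [Ideal.absNorm_apply, Submodule.cardQuot_apply, Algebra.norm_eq_matrix_det B,
    Matrix.det_fin_two] at h
  rw [h]
  have b0 : B 0 = 1 := by
    ext <;> simp [B, coordEquiv, Module.Basis.coe_ofEquivFun]
  have b1 : B 1 = ii := by
    ext <;> simp [B, coordEquiv, Module.Basis.coe_ofEquivFun, ii]
  have hr : ∀ z i, B.repr z i = ![z.re, z.im] i := fun z i => rfl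
  simp only [Algebra.leftMulMatrix_eq_repr_mul, hr, b0, b1]
  rw [Zsqrtd.norm_def]
  simp [ii]

variable {π : GaussianInt}

lemma exists_pow_iff_pow_eq_one {K : Type*} [Field K] [Finite K] {x : K} (hx : x ≠ 0) {d : ℕ}
    (hd : d ∣ Nat.card K - 1) : (∃ y, x = y ^ d) ↔ x ^ ((Nat.card K - 1) / d) = 1 := by
  classical
  have := Fintype.ofFinite K
  obtain ⟨e, he⟩ := hd
  have hK : 0 < Nat.card K - 1 := by
    have := Finite.one_lt_card (α := K)
    omega
  have hd0 : 0 < d := Nat.pos_of_ne_zero (by rintro rfl; omega)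
  have he0 : 0 < e := Nat.pos_of_ne_zero (by rintro rfl; omega)
  have hdiv : (Nat.card K - 1) / d = e := by rw [he, Nat.mul_div_cancel_left _ hd0]
  rw [hdiv]
  constructor
  · rintro ⟨y, rfl⟩
    have hy : y ≠ 0 := by
      rintro rfl
      exact hx (zero_pow hd0.ne')
    rw [← pow_mul, ← he, Nat.card_eq_fintype_card]
    exact FiniteField.pow_card_sub_one_eq_one y hy
  · intro h
    obtain ⟨g, hg⟩ := IsCyclic.exists_generator (α := Kˣ)
    have hord : orderOf g = d * e := by
      rw [orderOf_eq_card_of_forall_mem_zpowers hg, Nat.card_units, he]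
    obtain ⟨n, hn⟩ := (mem_powers_iff_mem_zpowers.2 (hg (Units.mk0 x hx)))
    have h1 : g ^ (n * e) = 1 := by
      rw [pow_mul]
      change (g ^ n) = _ at hn
      rw [hn]
      ext
      simpa using h
    have h2 := orderOf_dvd_of_pow_eq_one h1
    rw [hord] at h2
    obtain ⟨c, rfl⟩ := Nat.dvd_of_mul_dvd_mul_right he0 h2
    refine ⟨((g ^ c : Kˣ) : K), ?_⟩
    change (g ^ (d * c)) = _ at hn
    rw [← Units.val_pow_eq_pow_val, ← pow_mul, mul_comm c d, hn, Units.val_mk0]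

lemma exists_dvd_sub_pow_iff (hπ : Prime π) {g : GaussianInt} (hg : ¬ π ∣ g) {d : ℕ}
    (hd : d ∣ π.norm.natAbs - 1) :
    (∃ y, π ∣ g - y ^ d) ↔ π ∣ g ^ ((π.norm.natAbs - 1) / d) - 1 := by
  have hI : (Ideal.span {π}).IsPrime := (Ideal.span_singleton_prime hπ.ne_zero).2 hπ
  have hmax : (Ideal.span {π}).IsMaximal := hI.isMaximal (by simpa using hπ.ne_zero)
  let _ : Field (GaussianInt ⧸ Ideal.span {π}) := Ideal.Quotient.field _
  have hcard := card_quotient_span π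
  have hfin : Finite (GaussianInt ⧸ Ideal.span {π}) := by
    apply Nat.finite_of_card_ne_zero
    rw [hcard, Int.natAbs_ne_zero, Ne, GaussianInt.norm_eq_zero]
    exact hπ.ne_zero
  have hmk : ∀ a b : GaussianInt, π ∣ a - b ↔
      Ideal.Quotient.mk (Ideal.span {π}) a = Ideal.Quotient.mk (Ideal.span {π}) b := by
    intro a b
    rw [Ideal.Quotient.eq, Ideal.mem_span_singleton]
  have hg0 : Ideal.Quotient.mk (Ideal.span {π}) g ≠ 0 := by
    rw [Ne, Ideal.Quotient.eq_zero_iff_mem, Ideal.mem_span_singleton]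
    exact hg
  rw [hmk, map_pow, map_one, ← hcard, ← exists_pow_iff_pow_eq_one hg0 (by rwa [hcard])]
  constructor
  · rintro ⟨y, hy⟩
    exact ⟨Ideal.Quotient.mk _ y, by rwa [hmk, map_pow] at hy⟩
  · rintro ⟨y, hy⟩
    obtain ⟨y, rfl⟩ := Ideal.Quotient.mk_surjective y
    exact ⟨y, by rwa [hmk, map_pow]⟩

/-- `QuarticSymbol π g k` says that `(g / π)₄ = i ^ k`. -/
def QuarticSymbol (π g : GaussianInt) (k : ZMod 4) : Prop :=
  π ∣ g ^ ((π.norm.natAbs - 1) / 4) - ii ^ k.val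

lemma ii_pow_val_add (k l : ZMod 4) : ii ^ (k + l).val = ii ^ k.val * ii ^ l.val := by
  rw [← pow_add]
  apply ii_pow_eq_of_modEq
  rw [ZMod.val_add]
  exact Nat.mod_modEq _ _

lemma QuarticSymbol.mul {g h : GaussianInt} {k l : ZMod 4} (hg : QuarticSymbol π g k)
    (hh : QuarticSymbol π h l) : QuarticSymbol π (g * h) (k + l) := by
  unfold QuarticSymbol at *
  rw [mul_pow, ii_pow_val_add]
  have := dvd_add (hg.mul_right (h ^ ((π.norm.natAbs - 1) / 4))) (hh.mul_left (ii ^ k.val))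
  exact this.trans (dvd_of_eq (by ring))

lemma QuarticSymbol.one : QuarticSymbol π 1 0 := by
  unfold QuarticSymbol
  simp

lemma QuarticSymbol.pow {g : GaussianInt} {k : ZMod 4} (hg : QuarticSymbol π g k) (n : ℕ) :
    QuarticSymbol π (g ^ n) (n * k) := by
  induction n with
  | zero => simpa using QuarticSymbol.one
  | succ n ih =>
    rw [pow_succ]
    convert ih.mul hg using 1
    push_cast
    ring

lemma QuarticSymbol.prod {ι : Type*} (s : Finset ι) {g : ι → GaussianInt} {k : ι → ZMod 4}
    (h : ∀ i ∈ s, QuarticSymbol π (g i) (k i)) :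
    QuarticSymbol π (∏ i ∈ s, g i) (∑ i ∈ s, k i) := by
  classical
  induction s using Finset.induction_on with
  | empty => simpa using QuarticSymbol.one
  | insert a s ha ih =>
    rw [Finset.prod_insert ha, Finset.sum_insert ha]
    exact (h a (Finset.mem_insert_self a s)).mul
      (ih fun i hi => h i (Finset.mem_insert_of_mem hi))

lemma isUnit_ii_pow (n : ℕ) : IsUnit (ii ^ n) :=
  IsUnit.pow n (IsUnit.of_mul_eq_one (-ii) (by linear_combination -ii_sq))

lemma one_lt_norm (hπ : Prime π) : 1 < π.norm.natAbs := by
  have h0 : π.norm.natAbs ≠ 0 := by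
    rw [Int.natAbs_ne_zero, Ne, GaussianInt.norm_eq_zero]
    exact hπ.ne_zero
  have h1 : π.norm.natAbs ≠ 1 := fun h => hπ.not_isUnit (Zsqrtd.norm_eq_one_iff.1 h)
  omega

lemma not_dvd_two (hπ : Prime π) (h4 : 4 ∣ π.norm.natAbs - 1) : ¬ π ∣ 2 := by
  rintro ⟨c, hc⟩
  have h1 := one_lt_norm hπ
  have h2 : π.norm.natAbs * c.norm.natAbs = 4 := by
    rw [← Int.natAbs_mul, ← Zsqrtd.norm_mul, ← hc]
    rfl
  have h3 := Nat.le_of_dvd (by norm_num) (Dvd.intro _ h2)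
  omega

lemma QuarticSymbol.not_dvd (hπ : Prime π) (h4 : 4 ∣ π.norm.natAbs - 1) {g : GaussianInt}
    {k : ZMod 4} (hg : QuarticSymbol π g k) : ¬ π ∣ g := by
  intro h
  have h1 := one_lt_norm hπ
  have h2 : π ∣ g ^ ((π.norm.natAbs - 1) / 4) := dvd_pow h (by omega)
  have h3 : π ∣ ii ^ k.val := by
    have := dvd_sub h2 hg
    simpa using this
  exact hπ.not_isUnit (isUnit_of_dvd_unit h3 (isUnit_ii_pow _))

lemma dvd_ii_pow_sub_one_iff (hπ : Prime π) (h4 : 4 ∣ π.norm.natAbs - 1) (n : ℕ) :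
    π ∣ ii ^ n - 1 ↔ 4 ∣ n := by
  have h2 := not_dvd_two hπ h4
  constructor
  · intro h
    rw [ii_pow_eq_of_modEq (Nat.mod_modEq n 4).symm] at h
    have hlt := Nat.mod_lt n (show 0 < 4 by norm_num)
    rw [Nat.dvd_iff_mod_eq_zero]
    generalize n % 4 = r at *
    interval_cases r
    · rfl
    · exact absurd (h.trans ⟨-(ii + 1), by linear_combination ii_sq⟩) h2
    · exact absurd (h.trans ⟨-1, by linear_combination ii_sq⟩) h2
    · exact absurd (h.trans ⟨ii - 1, by linear_combination (-ii ^ 2 + ii + 1) * ii_sq⟩) h2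
  · rintro ⟨c, rfl⟩
    rw [pow_mul, ii_pow_four, one_pow, sub_self]
    exact dvd_zero _

lemma QuarticSymbol.exists_pow_four_iff (hπ : Prime π) (h4 : 4 ∣ π.norm.natAbs - 1)
    {g : GaussianInt} {k : ZMod 4} (hg : QuarticSymbol π g k) :
    (∃ y, π ∣ g - y ^ 4) ↔ k = 0 := by
  rw [exists_dvd_sub_pow_iff hπ (hg.not_dvd hπ h4) h4]
  have h1 : π ∣ g ^ ((π.norm.natAbs - 1) / 4) - 1 ↔ π ∣ ii ^ k.val - 1 := by
    unfold QuarticSymbol at hg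
    constructor
    · intro h
      have := dvd_sub h hg
      exact this.trans (dvd_of_eq (by ring))
    · intro h
      have := dvd_add h hg
      exact this.trans (dvd_of_eq (by ring))
  rw [h1, dvd_ii_pow_sub_one_iff hπ h4]
  clear h1 hg
  revert k
  decide

lemma QuarticSymbol.exists_sq_iff (hπ : Prime π) (h4 : 4 ∣ π.norm.natAbs - 1)
    {g : GaussianInt} {k : ZMod 4} (hg : QuarticSymbol π g k) :
    (∃ y, π ∣ g - y ^ 2) ↔ c2 k = 0 := by
  rw [exists_dvd_sub_pow_iff hπ (hg.not_dvd hπ h4) (dvd_trans (by norm_num) h4)]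
  have h0 : (π.norm.natAbs - 1) / 2 = (π.norm.natAbs - 1) / 4 * 2 := by omega
  have h1 : π ∣ g ^ ((π.norm.natAbs - 1) / 2) - 1 ↔ π ∣ ii ^ (k.val * 2) - 1 := by
    rw [h0]
    unfold QuarticSymbol at hg
    have hg2 := hg.mul_right (g ^ ((π.norm.natAbs - 1) / 4) + ii ^ k.val)
    constructor
    · intro h
      have := dvd_sub h hg2
      exact this.trans (dvd_of_eq (by ring))
    · intro h
      have := dvd_add h hg2
      exact this.trans (dvd_of_eq (by ring))
  rw [h1, dvd_ii_pow_sub_one_iff hπ h4]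
  clear h1 hg
  revert k
  unfold c2
  decide

end Residue

section SquareRoot

open WithZero Filter Topology MonoidWithZeroHom

variable {K : Type*} [Field K] [Valued K ℤᵐ⁰]

/-- Nested approximations converge in a complete valued field. -/
lemma exists_tendsto_of_valuation_le [CompleteSpace K] {e : ℕ → K} {ρ : ℤᵐ⁰} (hρ : ρ < 1)
    (he : ∀ n, Valued.v (e (n + 1) - e n) ≤ ρ ^ n) : ∃ l, Tendsto e atTop (𝓝 l) := by
  have hm : ∀ n k, Valued.v (e (n + k) - e n) ≤ ρ ^ n := by
    intro n k
    induction k with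
    | zero => simp
    | succ k ih =>
      have h1 : e (n + (k + 1)) - e n = (e (n + k + 1) - e (n + k)) + (e (n + k) - e n) := by
        rw [← add_assoc]
        ring
      rw [h1]
      refine Valuation.map_add_le _ ((he _).trans ?_) ih
      exact pow_le_pow_right_of_le_one' hρ.le (Nat.le_add_right n k)
  apply cauchySeq_tendsto_of_complete
  rw [CauchySeq, Valued.cauchy_iff]
  refine ⟨inferInstance, fun γ => ?_⟩
  obtain ⟨n, hn⟩ := exists_pow_lt₀ hρ
    (Units.mk0 (ValueGroup₀.embedding γ.1) (by simp))
  refine ⟨e '' Set.Ici n, Filter.image_mem_map (Filter.mem_atTop n), ?_⟩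
  rintro _ ⟨i, hi, rfl⟩ _ ⟨j, hj, rfl⟩
  obtain ⟨i, rfl⟩ := Nat.exists_eq_add_of_le (Set.mem_Ici.1 hi)
  obtain ⟨j, rfl⟩ := Nat.exists_eq_add_of_le (Set.mem_Ici.1 hj)
  rw [Valuation.restrict_lt_iff_lt_embedding]
  refine lt_of_le_of_lt ?_ hn
  have h1 : e (n + j) - e (n + i) = (e (n + j) - e n) - (e (n + i) - e n) := by ring
  rw [h1]
  exact Valuation.map_sub_le _ (hm _ _) (hm _ _)

/-- Elements close to `1` have a square root close to `1` when `2` is a unit. -/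
lemma exists_sq_eq_of_valuation_sub_one_lt [CompleteSpace K] [T2Space K]
    (h2 : Valued.v (2 : K) = 1) {x : K} (hx : Valued.v (x - 1) < 1) :
    ∃ s : K, s ^ 2 = x ∧ Valued.v (s - 1) < 1 := by
  have h20 : (2 : K) ≠ 0 := by
    intro h
    simp [h] at h2
  set ρ : ℤᵐ⁰ := Valued.v (x - 1) with hρ
  let f : K → K := fun e => ((x - 1) - e ^ 2) / 2
  let e : ℕ → K := fun n => f^[n] 0
  have hs : ∀ n, e (n + 1) = f (e n) := fun n => Function.iterate_succ_apply' f n 0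
  have hb : ∀ n, Valued.v (e n) ≤ ρ := by
    intro n
    induction n with
    | zero => simp [e]
    | succ n ih =>
      rw [hs]
      simp only [f, map_div₀, h2, div_one]
      refine Valuation.map_sub_le _ le_rfl ?_
      rw [map_pow, pow_two]
      exact (mul_le_mul' ih (ih.trans hx.le)).trans (mul_one ρ).le
  have hd : ∀ n, Valued.v (e (n + 1) - e n) ≤ ρ ^ n := by
    intro n
    induction n with
    | zero => simpa using Valuation.map_sub_le _ ((hb 1).trans hx.le) ((hb 0).trans hx.le)
    | succ n ih =>
      have h1 : e (n + 1 + 1) - e (n + 1) = -((e (n + 1) + e n) * (e (n + 1) - e n)) / 2 := by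
        rw [hs (n + 1), hs n]
        simp only [f]
        ring
      rw [h1, map_div₀, h2, div_one, Valuation.map_neg, map_mul, pow_succ']
      exact mul_le_mul' (Valuation.map_add_le _ (hb _) (hb _)) ih
  obtain ⟨l, hl⟩ := exists_tendsto_of_valuation_le hx hd
  have hf : Continuous f := by fun_prop
  have hfl : f l = l := by
    refine tendsto_nhds_unique ((hf.tendsto l).comp hl) ?_
    refine ((tendsto_add_atTop_iff_nat 1).2 hl).congr fun n => ?_
    exact hs n
  have hvl : Valued.v l < 1 := by
    have hn : {y : K | Valued.v (y - l) < 1} ∈ 𝓝 l := by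
      rw [Valued.mem_nhds]
      refine ⟨1, fun y hy => ?_⟩
      simpa [Valuation.restrict_lt_one_iff] using hy
    obtain ⟨n, hn⟩ := (hl.eventually hn).exists
    have h1 : l = e n - (e n - l) := by ring
    rw [h1]
    exact Valuation.map_sub_lt _ ((hb n).trans_lt hx) hn
  refine ⟨1 + l, ?_, by simpa using hvl⟩
  have : (x - 1) - l ^ 2 = l * 2 := by
    rw [← div_eq_iff h20]
    exact hfl
  linear_combination -this

end SquareRoot

section LocalModel

open WithZero

/-- A valued field that contains the Gaussian integers, is complete enough to have square roots
near `1`, and whose residue field is `ℤ[i]/π`. -/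
structure LocalModel {K : Type*} [Field K] (V : Valuation K ℤᵐ⁰) (φ : GaussianInt →+* K)
    (π : GaussianInt) : Prop where
  le_one : ∀ g, V (φ g) ≤ 1
  lt_one_iff : ∀ g, V (φ g) < 1 ↔ π ∣ g
  uniformizer : V (φ π) = exp (-1)
  approx : ∀ x, V x ≤ 1 → ∃ g, V (x - φ g) < 1
  sqrt : ∀ x, V (x - 1) < 1 → ∃ s, s ^ 2 = x ∧ V (s - 1) < 1

lemma localModel_adicCompletion {π : GaussianInt} (hπ : Prime π) (h2 : ¬ π ∣ 2)
    (v : HeightOneSpectrum GaussianInt) (hv : v.asIdeal = Ideal.span {π}) :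
    LocalModel (K := v.adicCompletion (FractionRing GaussianInt)) Valued.v
      (algebraMap GaussianInt _) π := by
  have hval : ∀ g : GaussianInt, Valued.v (algebraMap GaussianInt
      (v.adicCompletion (FractionRing GaussianInt)) g) = v.intValuation g := by
    intro g
    rw [← v.valuation_of_algebraMap (K := FractionRing GaussianInt)]
    exact v.valuedAdicCompletion_eq_valuation g
  have hlt : ∀ g : GaussianInt, Valued.v (algebraMap GaussianInt
      (v.adicCompletion (FractionRing GaussianInt)) g) < 1 ↔ π ∣ g := by
    intro g
    rw [hval, v.intValuation_lt_one_iff_mem, hv, Ideal.mem_span_singleton]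
  have hle : ∀ g : GaussianInt, Valued.v (algebraMap GaussianInt
      (v.adicCompletion (FractionRing GaussianInt)) g) ≤ 1 := by
    intro g
    rw [hval]
    exact v.intValuation_le_one g
  refine ⟨hle, hlt, ?_, ?_, ?_⟩
  · rw [hval]
    exact v.intValuation_singleton hπ.ne_zero hv
  · intro x hx
    have hn : {y | Valued.v (y - x) < 1} ∈ nhds x := by
      rw [Valued.mem_nhds]
      refine ⟨1, fun y hy => ?_⟩
      simpa [Valuation.restrict_lt_one_iff] using hy
    obtain ⟨_, hk, k, rfl⟩ := mem_closure_iff_nhds.1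
      ((v.denseRange_algebraMap (K := FractionRing GaussianInt)) x) _ hn
    have hk1 : v.valuation (FractionRing GaussianInt) k ≤ 1 := by
      rw [← v.valuedAdicCompletion_eq_valuation' k]
      have h1 : (k : v.adicCompletion (FractionRing GaussianInt)) = (k - x) + x := by ring
      rw [h1]
      exact Valuation.map_add_le _ hk.le hx
    obtain ⟨g, hg⟩ := v.exists_valuation_sub_lt_of_integer hk1 1
    refine ⟨g, ?_⟩
    have h2 : Valued.v (algebraMap GaussianInt (v.adicCompletion (FractionRing GaussianInt)) g
        - algebraMap (FractionRing GaussianInt) _ k) < 1 := by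
      rw [IsScalarTower.algebraMap_apply GaussianInt (FractionRing GaussianInt)
        (v.adicCompletion (FractionRing GaussianInt)), ← map_sub]
      exact (v.valuedAdicCompletion_eq_valuation' _).trans_lt hg
    rw [Valuation.map_sub_swap]
    have h3 := Valuation.map_add_lt _ h2 hk
    simpa using h3
  · intro x hx
    refine exists_sq_eq_of_valuation_sub_one_lt ?_ hx
    have h3 := hle 2
    have h4 := mt (hlt 2).1 h2
    rw [map_ofNat] at h3 h4
    exact le_antisymm h3 (not_lt.1 h4)

end LocalModel

section LeadingTerm

open WithZero

variable {K : Type*} [Field K] {V : Valuation K ℤᵐ⁰} {φ : GaussianInt →+* K} {π : GaussianInt}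

/-- `x` has valuation `n` and its leading coefficient reduces to `g` modulo `π`. -/
def Lead (V : Valuation K ℤᵐ⁰) (φ : GaussianInt →+* K) (π : GaussianInt) (x : K) (n : ℤ)
    (g : GaussianInt) : Prop :=
  ¬ π ∣ g ∧ ∃ u, x = φ π ^ n * u ∧ V (u - φ g) < 1

namespace LocalModel

lemma eq_one (H : LocalModel V φ π) {g : GaussianInt} (hg : ¬ π ∣ g) : V (φ g) = 1 :=
  le_antisymm (H.le_one g) (not_lt.1 (mt (H.lt_one_iff g).1 hg))

lemma map_ne_zero (H : LocalModel V φ π) {g : GaussianInt} (hg : ¬ π ∣ g) : φ g ≠ 0 := by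
  intro h
  have := H.eq_one hg
  simp [h] at this

lemma uniformizer_ne_zero (H : LocalModel V φ π) : φ π ≠ 0 := by
  intro h
  have := H.uniformizer
  rw [h, map_zero] at this
  exact exp_ne_zero this.symm

lemma eq_one_of_sub_lt (H : LocalModel V φ π) {g : GaussianInt} (hg : ¬ π ∣ g) {u : K} (hu : V
    (u - φ g) < 1) :
    V u = 1 := by
  have h1 := H.eq_one hg
  rw [← h1] at hu ⊢
  have := Valuation.map_add_eq_of_lt_left V hu
  rwa [add_sub_cancel] at this

lemma uniformizer_zpow (H : LocalModel V φ π) (n : ℤ) : V (φ π ^ n) = exp (-n) := by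
  rw [map_zpow₀, H.uniformizer, ← exp_zsmul]
  simp

lemma dvd_sub_of_sub_lt (H : LocalModel V φ π) {g h : GaussianInt} {u : K} (hg : V (u - φ g) < 1)
    (hh : V (u - φ h) < 1) : π ∣ g - h := by
  rw [← H.lt_one_iff, map_sub]
  have h1 : φ g - φ h = (u - φ h) - (u - φ g) := by ring
  rw [h1]
  exact Valuation.map_sub_lt _ hh hg

lemma lead_of_not_dvd {g : GaussianInt} (hg : ¬ π ∣ g) : Lead V φ π (φ g) 0 g :=
  ⟨hg, φ g, by simp, by simp⟩

lemma lead_uniformizer (hπ : Prime π) : Lead V φ π (φ π) 1 1 :=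
  ⟨fun h => hπ.not_isUnit (isUnit_of_dvd_one h), 1, by simp, by simp⟩

lemma lead_exists (H : LocalModel V φ π) {x : K} (hx : x ≠ 0) : ∃ n g, Lead V φ π x n g := by
  have hV : V x ≠ 0 := (Valuation.ne_zero_iff V).2 hx
  have hp := H.uniformizer_ne_zero
  set n : ℤ := -(log (V x)) with hn
  have hu : V (φ π ^ (-n) * x) = 1 := by
    rw [map_mul, H.uniformizer_zpow, neg_neg, hn, exp_neg, exp_log hV, inv_mul_cancel₀ hV]
  obtain ⟨g, hg⟩ := H.approx _ hu.le
  refine ⟨n, g, ?_, φ π ^ (-n) * x, ?_, hg⟩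
  · intro h
    rw [← H.lt_one_iff] at h
    have h1 := Valuation.map_add_lt V hg h
    rw [sub_add_cancel, hu] at h1
    exact lt_irrefl _ h1
  · rw [← mul_assoc, ← zpow_add₀ hp]
    simp

lemma lead_valuation (H : LocalModel V φ π) {x : K} {n : ℤ} {g : GaussianInt}
    (h : Lead V φ π x n g) :
    V x = exp (-n) := by
  obtain ⟨hg, u, rfl, hu⟩ := h
  rw [map_mul, H.uniformizer_zpow, H.eq_one_of_sub_lt hg hu, mul_one]

lemma lead_ne_zero (H : LocalModel V φ π) {x : K} {n : ℤ} {g : GaussianInt}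
    (h : Lead V φ π x n g) : x ≠ 0 := by
  rintro rfl
  have := H.lead_valuation h
  rw [map_zero] at this
  exact exp_ne_zero this.symm

lemma lead_unique (H : LocalModel V φ π) {x : K} {n k : ℤ} {g h : GaussianInt}
    (hg : Lead V φ π x n g)
    (hh : Lead V φ π x k h) : n = k ∧ π ∣ g - h := by
  have h1 : n = k := by
    have := (H.lead_valuation hg).symm.trans (H.lead_valuation hh)
    simpa using this
  subst h1
  obtain ⟨_, u, rfl, hu⟩ := hg
  obtain ⟨_, w, hw, hw'⟩ := hh
  have h2 := mul_left_cancel₀ (zpow_ne_zero n H.uniformizer_ne_zero) hw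
  subst h2
  exact ⟨rfl, H.dvd_sub_of_sub_lt hu hw'⟩

lemma lead_mul (H : LocalModel V φ π) (hπ : Prime π) {x y : K} {n k : ℤ} {g h : GaussianInt}
    (hg : Lead V φ π x n g)
    (hh : Lead V φ π y k h) : Lead V φ π (x * y) (n + k) (g * h) := by
  obtain ⟨hg, u, rfl, hu⟩ := hg
  obtain ⟨hh, w, rfl, hw⟩ := hh
  refine ⟨fun hd => (hπ.dvd_or_dvd hd).elim hg hh, u * w, ?_, ?_⟩
  · rw [zpow_add₀ H.uniformizer_ne_zero]
    ring
  · have h1 : u * w - φ (g * h) = (u - φ g) * w + φ g * (w - φ h) := by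
      rw [map_mul]
      ring
    rw [h1]
    apply Valuation.map_add_lt
    · rw [map_mul, H.eq_one_of_sub_lt hh hw, mul_one]
      exact hu
    · rw [map_mul, H.eq_one hg, one_mul]
      exact hw

lemma lead_pow (H : LocalModel V φ π) (hπ : Prime π) {x : K} {n : ℤ} {g : GaussianInt}
    (hg : Lead V φ π x n g) (k : ℕ) :
    Lead V φ π (x ^ k) (k * n) (g ^ k) := by
  induction k with
  | zero =>
    have h1 : Lead V φ π (φ 1) 0 1 :=
      lead_of_not_dvd fun h => hπ.not_isUnit (isUnit_of_dvd_one h)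
    simpa using h1
  | succ k ih =>
    rw [pow_succ, pow_succ]
    convert H.lead_mul hπ ih hg using 1
    push_cast
    ring

lemma lead_add_of_lt (H : LocalModel V φ π) {x y : K} {n k : ℤ} {g h : GaussianInt}
    (hg : Lead V φ π x n g)
    (hh : Lead V φ π y k h) (hnk : n < k) : Lead V φ π (x + y) n g := by
  obtain ⟨hg, u, rfl, hu⟩ := hg
  refine ⟨hg, u + φ π ^ (-n) * y, ?_, ?_⟩
  · rw [mul_add, ← mul_assoc, ← zpow_add₀ H.uniformizer_ne_zero]
    simp
  · have h1 : u + φ π ^ (-n) * y - φ g = (u - φ g) + φ π ^ (-n) * y := by ring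
    rw [h1]
    apply Valuation.map_add_lt _ hu
    rw [map_mul, H.uniformizer_zpow, H.lead_valuation hh, ← exp_add, ← exp_zero, exp_lt_exp]
    omega

lemma lead_add {x y : K} {n : ℤ} {g h : GaussianInt} (hg : Lead V φ π x n g)
    (hh : Lead V φ π y n h) (hgh : ¬ π ∣ g + h) : Lead V φ π (x + y) n (g + h) := by
  obtain ⟨hg, u, rfl, hu⟩ := hg
  obtain ⟨hh, w, rfl, hw⟩ := hh
  refine ⟨hgh, u + w, by ring, ?_⟩
  have h1 : u + w - φ (g + h) = (u - φ g) + (w - φ h) := by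
    rw [map_add]
    ring
  rw [h1]
  exact Valuation.map_add_lt _ hu hw

lemma sub_one_lt (H : LocalModel V φ π) {u : K} {g : GaussianInt} (hg : ¬ π ∣ g) (hu : V
    (u - φ g) < 1) :
    V (u / φ g - 1) < 1 := by
  have h0 := H.map_ne_zero hg
  have h1 : u / φ g - 1 = (u - φ g) / φ g := by field_simp
  rw [h1, map_div₀, H.eq_one hg, div_one]
  exact hu

lemma exists_sq_eq (H : LocalModel V φ π) {x : K} {n : ℤ} {g y : GaussianInt} (hx : Lead V φ π x
    (2 * n) g)
    (hy : π ∣ g - y ^ 2) : ∃ s, s ^ 2 = x := by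
  obtain ⟨hg, u, rfl, hu⟩ := hx
  have hy0 : ¬ π ∣ y ^ 2 := fun h => hg ((dvd_sub_left h).1 hy)
  have hu2 : V (u - φ (y ^ 2)) < 1 := by
    rw [← H.lt_one_iff] at hy
    have := Valuation.map_add_lt V hu hy
    simpa using this
  obtain ⟨s, hs, -⟩ := H.sqrt _ (H.sub_one_lt hy0 hu2)
  refine ⟨φ π ^ n * (φ y * s), ?_⟩
  have h0 := H.map_ne_zero hy0
  rw [eq_div_iff h0, map_pow] at hs
  rw [mul_comm 2 n, zpow_mul, mul_pow, mul_pow, ← hs]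
  norm_cast
  ring

lemma exists_pow_four_eq (H : LocalModel V φ π) {u : K} {y : GaussianInt} (hy : ¬ π ∣ y ^ 4)
    (hu : V (u - φ (y ^ 4)) < 1) : ∃ s, s ^ 4 = u := by
  obtain ⟨s, hs, hs1⟩ := H.sqrt _ (H.sub_one_lt hy hu)
  obtain ⟨t, ht, -⟩ := H.sqrt _ hs1
  refine ⟨φ y * t, ?_⟩
  have h0 := H.map_ne_zero hy
  rw [eq_div_iff h0, map_pow, ← ht] at hs
  rw [← hs]
  ring

end LocalModel

end LeadingTerm

section LocalPoints

open WithZero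

variable {K : Type*} [Field K] {V : Valuation K ℤᵐ⁰} {φ : GaussianInt →+* K} {π : GaussianInt}

/-- The curve `D w² = D² + B z⁴` has a point over the field, possibly at infinity. -/
def CurvePoint (D B : K) : Prop :=
  (∃ z w, D * w ^ 2 = D ^ 2 + B * z ^ 4) ∨ ∃ u, u ^ 2 * D = B

lemma exists_mul_dvd_sub_one (hπ : Prime π) {y : GaussianInt} (hy : ¬ π ∣ y) :
    ∃ y', π ∣ y * y' - 1 := by
  obtain ⟨a, c, h⟩ := (hπ.irreducible.coprime_iff_not_dvd).2 hy
  exact ⟨c, -a, by linear_combination h⟩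

lemma exists_dvd_sub_sq (hπ : Prime π) {x y z : GaussianInt} (hy : ¬ π ∣ y)
    (h : π ∣ x * y ^ 2 - z ^ 2) : ∃ s, π ∣ x - s ^ 2 := by
  obtain ⟨y', hy'⟩ := exists_mul_dvd_sub_one hπ hy
  refine ⟨z * y', ?_⟩
  have := dvd_sub (h.mul_right (y' ^ 2)) (hy'.mul_right ((y * y' + 1) * x))
  exact this.trans (dvd_of_eq (by ring))

namespace LocalModel

lemma affine_cases (H : LocalModel V φ π) (hπ : Prime π) {D B z w : K} {e r : ℤ}
    {δ β : GaussianInt} (hD : Lead V φ π D e δ) (hB : Lead V φ π B r β)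
    (h : D * w ^ 2 = D ^ 2 + B * z ^ 4) :
    (∃ a g, e = 2 * a ∧ ¬ π ∣ g ∧ π ∣ δ * g ^ 2 - δ ^ 2) ∨
    (∃ a g c k, e + 2 * a = r + 4 * c ∧ ¬ π ∣ g ∧ ¬ π ∣ k ∧ π ∣ δ * g ^ 2 - β * k ^ 4) ∨
    (∃ c k, 2 * e = r + 4 * c ∧ π ∣ δ ^ 2 + β * k ^ 4) ∨
    (∃ a c, e = 2 * a ∧ 2 * e = r + 4 * c) := by
  have hD2 := H.lead_pow hπ hD 2
  push_cast at hD2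
  have key : ∀ {n : ℤ} {s : GaussianInt}, Lead V φ π (D ^ 2 + B * z ^ 4) n s →
      ∃ a g, e + 2 * a = n ∧ ¬ π ∣ g ∧ π ∣ δ * g ^ 2 - s := by
    intro n s hs
    have hw : w ≠ 0 := by
      rintro rfl
      refine H.lead_ne_zero hs ?_
      rw [← h]
      ring
    obtain ⟨a, g, hg⟩ := H.lead_exists hw
    have h1 := H.lead_mul hπ hD (H.lead_pow hπ hg 2)
    rw [h] at h1
    obtain ⟨h2, h3⟩ := H.lead_unique h1 hs
    push_cast at h2
    exact ⟨a, g, h2, hg.1, h3⟩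
  by_cases hz : z = 0
  · subst hz
    have h1 : D ^ 2 + B * 0 ^ 4 = D ^ 2 := by ring
    rw [h1] at key
    obtain ⟨a, g, h2, h3, h4⟩ := key hD2
    exact Or.inl ⟨a, g, by omega, h3, h4⟩
  obtain ⟨c, k, hk⟩ := H.lead_exists hz
  have hBz := H.lead_mul hπ hB (H.lead_pow hπ hk 4)
  push_cast at hBz
  rcases lt_trichotomy (2 * e) (r + 4 * c) with hlt | heq | hgt
  · obtain ⟨a, g, h2, h3, h4⟩ := key (H.lead_add_of_lt hD2 hBz hlt)
    exact Or.inl ⟨a, g, by omega, h3, h4⟩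
  · by_cases hd : π ∣ δ ^ 2 + β * k ^ 4
    · exact Or.inr (Or.inr (Or.inl ⟨c, k, heq, hd⟩))
    · rw [heq] at hD2
      obtain ⟨a, g, h2, h3, h4⟩ := key (lead_add hD2 hBz hd)
      exact Or.inr (Or.inr (Or.inr ⟨a, c, by omega, heq⟩))
  · rw [add_comm] at key
    obtain ⟨a, g, h2, h3, h4⟩ := key (H.lead_add_of_lt hBz hD2 hgt)
    exact Or.inr (Or.inl ⟨a, g, c, k, h2, h3, hk.1, h4⟩)

lemma infinity_case (H : LocalModel V φ π) (hπ : Prime π) {D B u : K} {e r : ℤ}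
    {δ β : GaussianInt} (hD : Lead V φ π D e δ) (hB : Lead V φ π B r β) (h : u ^ 2 * D = B) :
    ∃ a g, e + 2 * a = r ∧ ¬ π ∣ g ∧ π ∣ δ * g ^ 2 - β := by
  have hu : u ≠ 0 := by
    rintro rfl
    refine H.lead_ne_zero hB ?_
    rw [← h]
    ring
  obtain ⟨a, g, hg⟩ := H.lead_exists hu
  have h1 := H.lead_mul hπ (H.lead_pow hπ hg 2) hD
  rw [h] at h1
  obtain ⟨h2, h3⟩ := H.lead_unique h1 hB
  push_cast at h2
  exact ⟨a, g, by omega, hg.1, h3.trans (dvd_of_eq (by ring))⟩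

lemma curvePoint_of_sq_left (H : LocalModel V φ π) {D B : K} {e : ℤ} {δ y : GaussianInt}
    (hD : Lead V φ π D (2 * e) δ) (hy : π ∣ δ - y ^ 2) : CurvePoint D B := by
  obtain ⟨s, hs⟩ := H.exists_sq_eq hD hy
  exact Or.inl ⟨0, s, by rw [hs]; ring⟩

lemma curvePoint_of_sq_mul (H : LocalModel V φ π) (hπ : Prime π) {D B : K} {e r n : ℤ}
    {δ β y : GaussianInt} (hD : Lead V φ π D e δ) (hB : Lead V φ π B r β) (hn : r + e = 2 * n)
    (hy : π ∣ β * δ - y ^ 2) : CurvePoint D B := by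
  have h1 := H.lead_mul hπ hB hD
  rw [hn] at h1
  obtain ⟨s, hs⟩ := H.exists_sq_eq h1 hy
  have hD0 := H.lead_ne_zero hD
  refine Or.inr ⟨s / D, ?_⟩
  field_simp
  rw [hs, mul_comm]

lemma exists_sq_mul_of_dvd (hπ : Prime π) {δ β g k : GaussianInt} (hk : ¬ π ∣ k)
    (h : π ∣ δ * g ^ 2 - β * k ^ 4) : ∃ y, π ∣ β * δ - y ^ 2 := by
  refine exists_dvd_sub_sq (y := k ^ 2) (z := δ * g) hπ (fun hd => hk (hπ.dvd_of_dvd_pow hd)) ?_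
  exact (h.mul_right (-δ)).trans (dvd_of_eq (by ring))

lemma curvePoint_iff_of_odd (H : LocalModel V φ π) (hπ : Prime π) {D B : K} {r : ℤ}
    {δ β : GaussianInt} (hD : Lead V φ π D 0 δ) (hB : Lead V φ π B r β) (hr : Odd r) :
    CurvePoint D B ↔ ∃ y, π ∣ δ - y ^ 2 := by
  obtain ⟨l, rfl⟩ := hr
  constructor
  · rintro (⟨z, w, h⟩ | ⟨u, h⟩)
    · obtain ⟨a, g, h1, h2, h3⟩ | ⟨a, g, c, k, h1, -⟩ | ⟨c, k, h1, -⟩ | ⟨a, c, -, h1⟩ :=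
        H.affine_cases hπ hD hB h
      · exact exists_dvd_sub_sq hπ h2 h3
      all_goals omega
    · obtain ⟨a, g, h1, -⟩ := H.infinity_case hπ hD hB h
      omega
  · rintro ⟨y, hy⟩
    exact H.curvePoint_of_sq_left (e := 0) (by simpa using hD) hy

lemma curvePoint_iff_of_odd_of_dvd (H : LocalModel V φ π) (hπ : Prime π) {D B : K} {r : ℤ}
    {δ β : GaussianInt} (hD : Lead V φ π D 1 δ) (hB : Lead V φ π B r β) (hr : Odd r) :
    CurvePoint D B ↔ ∃ y, π ∣ β * δ - y ^ 2 := by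
  obtain ⟨l, rfl⟩ := hr
  constructor
  · rintro (⟨z, w, h⟩ | ⟨u, h⟩)
    · obtain ⟨a, g, h1, -⟩ | ⟨a, g, c, k, -, -, h1, h2⟩ | ⟨c, k, h1, -⟩ | ⟨a, c, -, h1⟩ :=
        H.affine_cases hπ hD hB h
      · omega
      · exact exists_sq_mul_of_dvd hπ h1 h2
      all_goals omega
    · obtain ⟨a, g, -, -, h1⟩ := H.infinity_case hπ hD hB h
      exact ⟨δ * g, (h1.mul_right (-δ)).trans (dvd_of_eq (by ring))⟩
  · rintro ⟨y, hy⟩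
    exact H.curvePoint_of_sq_mul (n := l + 1) hπ hD hB (by ring) hy

lemma curvePoint_iff_of_two (H : LocalModel V φ π) (hπ : Prime π) {D B : K}
    {δ β : GaussianInt} (hD : Lead V φ π D 0 δ) (hB : Lead V φ π B 2 β) :
    CurvePoint D B ↔ (∃ y, π ∣ δ - y ^ 2) ∨ ∃ y, π ∣ β * δ - y ^ 2 := by
  constructor
  · rintro (⟨z, w, h⟩ | ⟨u, h⟩)
    · obtain ⟨a, g, h1, h2, h3⟩ | ⟨a, g, c, k, -, -, h1, h2⟩ | ⟨c, k, h1, -⟩ | ⟨a, c, -, h1⟩ :=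
        H.affine_cases hπ hD hB h
      · exact Or.inl (exists_dvd_sub_sq hπ h2 h3)
      · exact Or.inr (exists_sq_mul_of_dvd hπ h1 h2)
      all_goals omega
    · obtain ⟨a, g, -, -, h1⟩ := H.infinity_case hπ hD hB h
      exact Or.inr ⟨δ * g, (h1.mul_right (-δ)).trans (dvd_of_eq (by ring))⟩
  · rintro (⟨y, hy⟩ | ⟨y, hy⟩)
    · exact H.curvePoint_of_sq_left (e := 0) (by simpa using hD) hy
    · exact H.curvePoint_of_sq_mul (n := 1) hπ hD hB (by ring) hy

lemma curvePoint_iff_of_two_of_dvd (H : LocalModel V φ π) (hπ : Prime π) {δ β : GaussianInt}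
    (hδ : ¬ π ∣ δ) (hβ : ¬ π ∣ β) :
    CurvePoint (φ (π * δ)) (φ (π ^ 2 * β)) ↔ ∃ y, π ∣ δ ^ 2 + β * y ^ 4 := by
  have hp := lead_uniformizer (V := V) (φ := φ) hπ
  have hD := H.lead_mul hπ hp (lead_of_not_dvd hδ)
  have hB := H.lead_mul hπ (H.lead_pow hπ hp 2) (lead_of_not_dvd hβ)
  simp only [one_pow, one_mul, mul_one, add_zero, Nat.cast_ofNat, ← map_mul, ← map_pow] at hD hB
  constructor
  · rintro (⟨z, w, h⟩ | ⟨u, h⟩)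
    · obtain ⟨a, g, h1, -⟩ | ⟨a, g, c, k, h1, -⟩ | ⟨c, k, -, h1⟩ | ⟨a, c, h1, -⟩ :=
        H.affine_cases hπ hD hB h
      · omega
      · omega
      · exact ⟨k, h1⟩
      · omega
    · obtain ⟨a, g, h1, -⟩ := H.infinity_case hπ hD hB h
      omega
  · rintro ⟨y, hy⟩
    have hy4 : ¬ π ∣ y ^ 4 := fun h =>
      hδ (hπ.dvd_of_dvd_pow ((dvd_add_left (h.mul_left β)).1 hy))
    have hβ0 := H.map_ne_zero hβ
    obtain ⟨z, hz⟩ := H.exists_pow_four_eq (u := φ (π * δ - δ ^ 2) / φ β) hy4 (by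
      have h1 : φ (π * δ - δ ^ 2) / φ β - φ (y ^ 4)
          = φ (π * δ - (δ ^ 2 + β * y ^ 4)) / φ β := by
        simp only [map_sub, map_add, map_mul, map_pow]
        field_simp
        ring
      rw [h1, map_div₀, H.eq_one hβ, div_one, H.lt_one_iff]
      exact dvd_sub (dvd_mul_right π δ) hy)
    refine Or.inl ⟨z, φ π, ?_⟩
    rw [hz]
    simp only [map_sub, map_mul, map_pow]
    field_simp
    ring

end LocalModel

end LocalPoints

section LocalCriteria

variable {π : GaussianInt}

lemma tt_pow_four : tt ^ 4 = -4 := by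
  unfold tt
  linear_combination (ii ^ 2 + 4 * ii + 5) * ii_sq

lemma hasLocalPoint_iff (hπ : Prime π) (h2 : ¬ π ∣ 2) {b d : GaussianInt} {P : Prop}
    (h : ∀ {K : Type} [Field K] {V : Valuation K (WithZero (Multiplicative ℤ))}
      {φ : GaussianInt →+* K}, LocalModel V φ π → (CurvePoint (φ d) (φ b) ↔ P)) :
    HasLocalPoint b d π ↔ P := by
  have key : ∀ v : HeightOneSpectrum GaussianInt, v.asIdeal = Ideal.span {π} →
      (((∃ z w : v.adicCompletion (FractionRing GaussianInt),
        algebraMap GaussianInt _ d * w ^ 2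
          = (algebraMap GaussianInt _ d) ^ 2 - 4 * algebraMap GaussianInt _ b * z ^ 4)
      ∨ (∃ u : v.adicCompletion (FractionRing GaussianInt),
        u ^ 2 * algebraMap GaussianInt _ d = algebraMap GaussianInt _ b)) ↔ P) := by
    intro v hv
    have H := localModel_adicCompletion hπ h2 v hv
    rw [← h H]
    refine or_congr ?_ Iff.rfl
    have h4 : algebraMap GaussianInt (v.adicCompletion (FractionRing GaussianInt)) tt ^ 4 = -4 := by
      rw [← map_pow, tt_pow_four, map_neg, map_ofNat]
    have h0 : algebraMap GaussianInt (v.adicCompletion (FractionRing GaussianInt)) tt ≠ 0 := by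
      refine H.map_ne_zero fun hd => h2 ?_
      have h5 : π ∣ 2 ^ 2 := (hd.trans (dvd_pow_self tt (by norm_num : 4 ≠ 0))).trans
        ⟨-1, by linear_combination tt_pow_four⟩
      exact hπ.dvd_of_dvd_pow h5
    constructor
    · rintro ⟨z, w, hzw⟩
      refine ⟨algebraMap GaussianInt _ tt * z, w, ?_⟩
      rw [hzw, mul_pow, h4]
      ring
    · rintro ⟨z, w, hzw⟩
      refine ⟨z / algebraMap GaussianInt _ tt, w, ?_⟩
      have h6 : (4 : v.adicCompletion (FractionRing GaussianInt)) ≠ 0 := by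
        intro h6
        rw [h6, neg_zero] at h4
        exact h0 (pow_eq_zero_iff (by norm_num) |>.1 h4)
      rw [hzw, div_pow, h4]
      field_simp
      ring
  constructor
  · intro hl
    have hI : (Ideal.span {π}).IsPrime := (Ideal.span_singleton_prime hπ.ne_zero).2 hπ
    let v : HeightOneSpectrum GaussianInt := ⟨Ideal.span {π}, hI, by simpa using hπ.ne_zero⟩
    exact (key v rfl).1 (hl v rfl)
  · intro hP v hv
    exact (key v hv).2 hP

variable {δ β : GaussianInt} {k l : ZMod 4}

lemma hasLocalPoint_iff_of_odd (hπ : Prime π) (h4 : 4 ∣ π.norm.natAbs - 1)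
    (hδ : QuarticSymbol π δ k) (hβ : QuarticSymbol π β l) {r : ℕ} (hr : Odd r) :
    HasLocalPoint (π ^ r * β) δ π ↔ c2 k = 0 := by
  refine hasLocalPoint_iff hπ (not_dvd_two hπ h4) fun {K} _ {V} {φ} H => ?_
  have hp := LocalModel.lead_uniformizer (V := V) (φ := φ) hπ
  have hB := H.lead_mul hπ (H.lead_pow hπ hp r) (LocalModel.lead_of_not_dvd (hβ.not_dvd hπ h4))
  rw [← map_pow, ← map_mul] at hB
  rw [H.curvePoint_iff_of_odd hπ (LocalModel.lead_of_not_dvd (hδ.not_dvd hπ h4)) hB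
    (by simpa using hr), hδ.exists_sq_iff hπ h4]

lemma hasLocalPoint_iff_of_odd_of_dvd (hπ : Prime π) (h4 : 4 ∣ π.norm.natAbs - 1)
    (hδ : QuarticSymbol π δ k) (hβ : QuarticSymbol π β l) {r : ℕ} (hr : Odd r) :
    HasLocalPoint (π ^ r * β) (π * δ) π ↔ c2 (l + k) = 0 := by
  refine hasLocalPoint_iff hπ (not_dvd_two hπ h4) fun {K} _ {V} {φ} H => ?_
  have hp := LocalModel.lead_uniformizer (V := V) (φ := φ) hπ
  have hB := H.lead_mul hπ (H.lead_pow hπ hp r) (LocalModel.lead_of_not_dvd (hβ.not_dvd hπ h4))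
  have hD := H.lead_mul hπ hp (LocalModel.lead_of_not_dvd (hδ.not_dvd hπ h4))
  simp only [one_pow, one_mul, mul_one, add_zero, ← map_mul, ← map_pow] at hD hB
  rw [H.curvePoint_iff_of_odd_of_dvd hπ hD hB (by simpa using hr),
    (hβ.mul hδ).exists_sq_iff hπ h4]

lemma hasLocalPoint_iff_of_two (hπ : Prime π) (h4 : 4 ∣ π.norm.natAbs - 1)
    (hδ : QuarticSymbol π δ k) (hβ : QuarticSymbol π β l) :
    HasLocalPoint (π ^ 2 * β) δ π ↔ c2 k = 0 ∨ c2 (l + k) = 0 := by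
  refine hasLocalPoint_iff hπ (not_dvd_two hπ h4) fun {K} _ {V} {φ} H => ?_
  have hp := LocalModel.lead_uniformizer (V := V) (φ := φ) hπ
  have hB := H.lead_mul hπ (H.lead_pow hπ hp 2) (LocalModel.lead_of_not_dvd (hβ.not_dvd hπ h4))
  simp only [one_pow, one_mul, mul_one, add_zero, Nat.cast_ofNat, ← map_mul, ← map_pow] at hB
  rw [H.curvePoint_iff_of_two hπ (LocalModel.lead_of_not_dvd (hδ.not_dvd hπ h4)) hB,
    hδ.exists_sq_iff hπ h4, (hβ.mul hδ).exists_sq_iff hπ h4]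

lemma hasLocalPoint_iff_of_two_of_dvd (hπ : Prime π) (h4 : 4 ∣ π.norm.natAbs - 1)
    (hδ : QuarticSymbol π δ k) (hβ : QuarticSymbol π β l) {n : ZMod 4}
    (hi : QuarticSymbol π ii n) :
    HasLocalPoint (π ^ 2 * β) (π * δ) π ↔ l = 2 * (n + k) := by
  refine hasLocalPoint_iff hπ (not_dvd_two hπ h4) fun {K} _ {V} {φ} H => ?_
  rw [H.curvePoint_iff_of_two_of_dvd hπ (hδ.not_dvd hπ h4) (hβ.not_dvd hπ h4)]
  have h1 : (∃ y, π ∣ δ ^ 2 + β * y ^ 4) ↔ ∃ y, π ∣ ii ^ 2 * δ ^ 2 * β ^ 3 - y ^ 4 := by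
    constructor
    · rintro ⟨y, hy⟩
      refine ⟨β * y, (hy.mul_right (-β ^ 3)).trans (dvd_of_eq ?_)⟩
      rw [ii_sq]
      ring
    · rintro ⟨y, hy⟩
      obtain ⟨β', hβ'⟩ := exists_mul_dvd_sub_one hπ (hβ.not_dvd hπ h4)
      refine ⟨y * β', ?_⟩
      rw [ii_sq] at hy
      have h2 := (hβ'.mul_right ((β * β' + 1) * ((β * β') ^ 2 + 1) * (-δ ^ 2)))
      have h3 := hy.mul_right (-β * β' ^ 4)
      exact (dvd_add h2 h3).trans (dvd_of_eq (by ring))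
  rw [h1, (((hi.pow 2).mul (hδ.pow 2)).mul (hβ.pow 3)).exists_pow_four_iff hπ h4]
  clear h1 hδ hβ hi
  revert k l n
  decide

end LocalCriteria

section Assembly

lemma QuarticSymbol.prod_erase {ι : Type*} [DecidableEq ι] {π : GaussianInt} {P : ι → GaussianInt}
    {e : ι → ZMod 4} {v : ι} (hv : e v = 0) (h : ∀ w, v ≠ w → QuarticSymbol π (P w) (e w))
    (R : ι → ℕ) (s : Finset ι) :
    QuarticSymbol π (∏ w ∈ s.erase v, P w ^ R w) (∑ w ∈ s, R w * e w) := by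
  have h1 : ∑ w ∈ s, R w * e w = ∑ w ∈ s.erase v, R w * e w :=
    (Finset.sum_erase s (by rw [hv, mul_zero])).symm
  rw [h1]
  exact QuarticSymbol.prod _ fun w hw => (h w (Finset.ne_of_mem_erase hw).symm).pow _

lemma QuarticSymbol.ii_tt_prod_erase {ι : Type*} [DecidableEq ι] {π : GaussianInt}
    {P : ι → GaussianInt} {e : ι → ZMod 4} {v : ι} {m n : ZMod 4} (hi : QuarticSymbol π ii n)
    (ht : QuarticSymbol π tt m) (hv : e v = 0)
    (h : ∀ w, v ≠ w → QuarticSymbol π (P w) (e w)) (R : ι → ℕ) (s : Finset ι) (x y : ℕ) :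
    QuarticSymbol π (ii ^ x * tt ^ y * ∏ w ∈ s.erase v, P w ^ R w)
      (x * n + y * m + ∑ w ∈ s, R w * e w) :=
  ((hi.pow x).mul (ht.pow y)).mul (QuarticSymbol.prod_erase hv h R s)

variable (E : (Fin M ⊕ Fin N) → (Fin M ⊕ Fin N) → ZMod 4) (r : Fin M → ℕ)

lemma degP_eq_sum (k : ℕ) (v : Fin M ⊕ Fin N) :
    degP E r k v = ∑ i, if r i = k then E v (Sum.inl i) else 0 := by
  unfold degP degSub
  rw [Finset.sum_image fun _ _ _ _ h => Sum.inl_injective h, Finset.sum_filter]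

lemma degQ_eq_sum (v : Fin M ⊕ Fin N) : degQ E v = ∑ j, E v (Sum.inr j) := by
  unfold degQ degSub
  rw [Finset.sum_image fun _ _ _ _ h => Sum.inr_injective h]

lemma degSub_univ (hr : ∀ i, r i = 1 ∨ r i = 3) (v : Fin M ⊕ Fin N) :
    degSub E Finset.univ v = degP E r 1 v + degP E r 3 v + degQ E v := by
  rw [degP_eq_sum, degP_eq_sum, degQ_eq_sum, degSub, Fintype.sum_sum_type,
    ← Finset.sum_add_distrib]
  congr 1
  refine Finset.sum_congr rfl fun i _ => ?_
  rcases hr i with h | h <;> simp [h]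

lemma sum_exponent_mul (hr : ∀ i, r i = 1 ∨ r i = 3) (v : Fin M ⊕ Fin N) :
    ∑ w, (Sum.elim r (fun _ => 2) w : ℕ) * E v w
      = degP E r 1 v + 3 * degP E r 3 v + 2 * degQ E v := by
  rw [degP_eq_sum, degP_eq_sum, degQ_eq_sum, Fintype.sum_sum_type, Finset.mul_sum,
    Finset.mul_sum, ← Finset.sum_add_distrib]
  congr 1
  refine Finset.sum_congr rfl fun i _ => ?_
  rcases hr i with h | h <;> simp [h]

lemma lap1_mulVec (Vd : Finset (Fin M ⊕ Fin N)) (v : Fin M ⊕ Fin N) :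
    (Lap1 E).mulVec (indVec Vd) v
      = (if v ∈ Vd then c2 (degSub E Finset.univ v) else 0) - c2 (degSub E Vd v) := by
  have h1 : ∀ w, Lap1 E v w * indVec Vd w
      = (if v = w then (if v ∈ Vd then c2 (degSub E Finset.univ v) else 0) else 0)
        - if w ∈ Vd then c2 (E v w) else 0 := by
    intro w
    unfold Lap1 indVec
    rw [map_sub]
    by_cases hvw : v = w
    · subst hvw
      by_cases hv : v ∈ Vd <;> simp [hv]
    · by_cases hw : w ∈ Vd <;> simp [hw, hvw]
  simp only [Matrix.mulVec, dotProduct, h1, Finset.sum_sub_distrib, Finset.sum_ite_eq,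
    Finset.mem_univ, if_true, degSub, map_sum, Finset.sum_ite_mem, Finset.univ_inter]

lemma eq_two_mul_iff (P Q : ZMod 4) :
    P = 2 * Q ↔ c2 P = 0 ∧ ((P.val / 2 : ℕ) : ZMod 2) = c2 Q := by
  unfold c2
  revert P Q
  decide

end Assembly

/-- **Statement 12.**  Linear-algebraic criterion for the local solubility conditions away
from `1+i`: with notation as in the paper, `C_d(ℚ(i)_v) ≠ ∅` for every odd prime `v ∣ b`
iff (1) `deg^{(1,3)}(q) ≡ m_q t_b + n_q s_b (mod 2)` for every `q_j ∣ d`, and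
(2) `L_b^{(1)} · 𝟙^{(d)} = y` for some `y` satisfying conditions (i)–(iv). -/
theorem lsc_away_matrix_criterion
    (M N : ℕ) (p : Fin M → GaussianInt) (q : Fin N → GaussianInt) (r : Fin M → ℕ)
    (sb tb : ℕ) (hsb : sb ≤ 3) (htb : tb ≤ 3) (hr : ∀ i, r i = 1 ∨ r i = 3)
    (hprime : ∀ v : Fin M ⊕ Fin N, Prime (Sum.elim p q v) ∧ IsPrimary (Sum.elim p q v))
    (hdist : Function.Injective (Sum.elim p q))
    (b : GaussianInt)
    (hb : b = ii ^ sb * tt ^ tb * (∏ i, p i ^ r i) * ∏ j, q j ^ 2)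
    (sd td : ℕ) (hsd : sd ≤ 1) (htd : td ≤ 1)
    (Vd : Finset (Fin M ⊕ Fin N)) (d : GaussianInt)
    (hd : d = ii ^ sd * tt ^ td * ∏ v ∈ Vd, Sum.elim p q v)
    (E : (Fin M ⊕ Fin N) → (Fin M ⊕ Fin N) → ZMod 4)
    (hE : ∀ v w, v ≠ w → Sum.elim p q v ∣
      (Sum.elim p q w ^ (((Sum.elim p q v).norm.natAbs - 1) / 4) - ii ^ (E v w).val))
    (hE0 : ∀ v, E v v = 0)
    (m4 n4 : (Fin M ⊕ Fin N) → ZMod 4)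
    (hmn : ∀ v, tt ^ 7 ∣ (Sum.elim p q v -
      (1 - 4 * ii) ^ (m4 v).val * (-1 - 6 * ii) ^ (n4 v).val)) :
    (∀ v : Fin M ⊕ Fin N, HasLocalPoint b d (Sum.elim p q v)) ↔
      ((∀ j : Fin N, Sum.inr j ∈ Vd →
          c2 (degP13 E r (Sum.inr j))
            = c2 (m4 (Sum.inr j)) * (tb : ZMod 2) + c2 (n4 (Sum.inr j)) * (sb : ZMod 2)) ∧
       (∃ y : (Fin M ⊕ Fin N) → ZMod 2, (Lap1 E).mulVec (indVec Vd) = y ∧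
         (∀ i : Fin M, Sum.inl i ∉ Vd →
            y (Sum.inl i)
              = c2 (m4 (Sum.inl i)) * (td : ZMod 2) + c2 (n4 (Sum.inl i)) * (sd : ZMod 2)) ∧
         (∀ i : Fin M, Sum.inl i ∈ Vd →
            y (Sum.inl i)
              = c2 (degQ E (Sum.inl i)) + c2 (m4 (Sum.inl i)) * ((tb : ZMod 2) + td)
                + c2 (n4 (Sum.inl i)) * ((sb : ZMod 2) + sd)) ∧
         (∀ j : Fin N, Sum.inr j ∉ Vd →
            y (Sum.inr j)
              = c2 (m4 (Sum.inr j)) * (td : ZMod 2) + c2 (n4 (Sum.inr j)) * (sd : ZMod 2) ∨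
            y (Sum.inr j)
              = c2 (degP13 E r (Sum.inr j)) + c2 (m4 (Sum.inr j)) * ((tb : ZMod 2) + td)
                + c2 (n4 (Sum.inr j)) * ((sb : ZMod 2) + sd)) ∧
         (∀ j : Fin N, Sum.inr j ∈ Vd →
            y (Sum.inr j)
              = c2 (degP E r 1 (Sum.inr j)) + c2 (m4 (Sum.inr j)) * (td : ZMod 2)
                + c2 (n4 (Sum.inr j)) * ((sd : ZMod 2) + 1)
                + (((degP13 E r (Sum.inr j) + m4 (Sum.inr j) * (tb : ZMod 4)
                      + n4 (Sum.inr j) * (sb : ZMod 4)).val / 2 : ℕ) : ZMod 2)))) := by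
  classical
  have two : (2 : ZMod 2) = 0 := rfl
  have h4 : ∀ v, 4 ∣ (Sum.elim p q v).norm.natAbs - 1 := fun v => four_dvd_norm_sub_one (hmn v)
  have hi : ∀ v, QuarticSymbol (Sum.elim p q v) ii (n4 v) := fun v => dvd_ii_pow_sub (hmn v)
  have ht : ∀ v, QuarticSymbol (Sum.elim p q v) tt (m4 v) :=
    fun v => dvd_tt_pow_sub (hprime v).1 (hmn v)
  let R : Fin M ⊕ Fin N → ℕ := Sum.elim r fun _ => 2
  have hbv : ∀ v, b = Sum.elim p q v ^ R v *
      (ii ^ sb * tt ^ tb * ∏ w ∈ Finset.univ.erase v, Sum.elim p q w ^ R w) := by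
    intro v
    have h1 := Finset.mul_prod_erase Finset.univ (fun w => Sum.elim p q w ^ R w)
      (Finset.mem_univ v)
    rw [mul_left_comm, h1, Fintype.prod_sum_type, hb]
    simp only [Sum.elim_inl, Sum.elim_inr, R, mul_assoc]
  have hβ : ∀ v, QuarticSymbol (Sum.elim p q v)
      (ii ^ sb * tt ^ tb * ∏ w ∈ Finset.univ.erase v, Sum.elim p q w ^ R w)
      (sb * n4 v + tb * m4 v + (degP E r 1 v + 3 * degP E r 3 v + 2 * degQ E v)) := by
    intro v
    rw [← sum_exponent_mul E r hr]
    exact QuarticSymbol.ii_tt_prod_erase (hi v) (ht v) (hE0 v) (hE v) R _ sb tb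
  have hδ : ∀ v, QuarticSymbol (Sum.elim p q v)
      (ii ^ sd * tt ^ td * ∏ w ∈ Vd.erase v, Sum.elim p q w)
      (sd * n4 v + td * m4 v + degSub E Vd v) := by
    intro v
    simpa [degSub] using
      QuarticSymbol.ii_tt_prod_erase (hi v) (ht v) (hE0 v) (hE v) (fun _ => 1) Vd sd td
  have hd_of_mem : ∀ v ∈ Vd, d = Sum.elim p q v *
      (ii ^ sd * tt ^ td * ∏ w ∈ Vd.erase v, Sum.elim p q w) := by
    intro v hv
    rw [mul_left_comm, Finset.mul_prod_erase Vd _ hv, hd]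
  have hd_of_notMem : ∀ v ∉ Vd, d = ii ^ sd * tt ^ td * ∏ w ∈ Vd.erase v, Sum.elim p q w := by
    intro v hv
    rw [Finset.erase_eq_of_notMem hv, hd]
  have hrodd : ∀ i, Odd (R (Sum.inl i)) := fun i => by
    change Odd (r i)
    rcases hr i with h | h <;> rw [h] <;> decide
  have hrtwo : ∀ j, R (Sum.inr j) = 2 := fun _ => rfl
  have hA : ∀ i, Sum.inl i ∉ Vd → (HasLocalPoint b d (Sum.elim p q (Sum.inl i)) ↔
      (Lap1 E).mulVec (indVec Vd) (Sum.inl i)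
        = c2 (m4 (Sum.inl i)) * (td : ZMod 2) + c2 (n4 (Sum.inl i)) * (sd : ZMod 2)) := by
    intro i hv
    rw [hbv (Sum.inl i), hd_of_notMem _ hv, hasLocalPoint_iff_of_odd (hprime _).1 (h4 _) (hδ _)
      (hβ _) (hrodd i), lap1_mulVec, if_neg hv]
    simp only [map_add, map_mul, map_natCast]
    constructor <;> intro h
    · linear_combination -h
    · linear_combination -h
  have hB : ∀ i, Sum.inl i ∈ Vd → (HasLocalPoint b d (Sum.elim p q (Sum.inl i)) ↔
      (Lap1 E).mulVec (indVec Vd) (Sum.inl i)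
        = c2 (degQ E (Sum.inl i)) + c2 (m4 (Sum.inl i)) * ((tb : ZMod 2) + td)
          + c2 (n4 (Sum.inl i)) * ((sb : ZMod 2) + sd)) := by
    intro i hv
    rw [hbv (Sum.inl i), hd_of_mem _ hv, hasLocalPoint_iff_of_odd_of_dvd (hprime _).1 (h4 _)
      (hδ _) (hβ _) (hrodd i), lap1_mulVec, if_pos hv, degSub_univ E r hr]
    simp only [map_add, map_mul, map_natCast, map_ofNat]
    generalize Sum.inl i = v
    constructor <;> intro h
    · linear_combination h - (c2 (m4 v) * (tb + td) + c2 (n4 v) * (sb + sd) + c2 (degSub E Vd v)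
        + c2 (degP E r 3 v) + c2 (degQ E v)) * two
    · linear_combination h + (c2 (m4 v) * (tb + td) + c2 (n4 v) * (sb + sd) + c2 (degSub E Vd v)
        + c2 (degP E r 3 v) + c2 (degQ E v)) * two
  have hC : ∀ j, Sum.inr j ∉ Vd → (HasLocalPoint b d (Sum.elim p q (Sum.inr j)) ↔
      ((Lap1 E).mulVec (indVec Vd) (Sum.inr j)
        = c2 (m4 (Sum.inr j)) * (td : ZMod 2) + c2 (n4 (Sum.inr j)) * (sd : ZMod 2) ∨
      (Lap1 E).mulVec (indVec Vd) (Sum.inr j)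
        = c2 (degP13 E r (Sum.inr j)) + c2 (m4 (Sum.inr j)) * ((tb : ZMod 2) + td)
          + c2 (n4 (Sum.inr j)) * ((sb : ZMod 2) + sd))) := by
    intro j hv
    rw [hbv (Sum.inr j), hrtwo, hd_of_notMem _ hv, hasLocalPoint_iff_of_two (hprime _).1 (h4 _)
      (hδ _) (hβ _), lap1_mulVec, if_neg hv, degP13]
    simp only [map_add, map_mul, map_natCast, map_ofNat]
    generalize Sum.inr j = v
    refine or_congr ?_ ?_ <;> constructor <;> intro h
    · linear_combination -h
    · linear_combination -h
    · linear_combination -h + (c2 (degP E r 3 v) + c2 (degQ E v)) * two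
    · linear_combination -h + (c2 (degP E r 3 v) + c2 (degQ E v)) * two
  have hD : ∀ j, Sum.inr j ∈ Vd → (HasLocalPoint b d (Sum.elim p q (Sum.inr j)) ↔
      (c2 (degP13 E r (Sum.inr j))
        = c2 (m4 (Sum.inr j)) * (tb : ZMod 2) + c2 (n4 (Sum.inr j)) * (sb : ZMod 2) ∧
      (Lap1 E).mulVec (indVec Vd) (Sum.inr j)
        = c2 (degP E r 1 (Sum.inr j)) + c2 (m4 (Sum.inr j)) * (td : ZMod 2)
          + c2 (n4 (Sum.inr j)) * ((sd : ZMod 2) + 1)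
          + (((degP13 E r (Sum.inr j) + m4 (Sum.inr j) * (tb : ZMod 4)
            + n4 (Sum.inr j) * (sb : ZMod 4)).val / 2 : ℕ) : ZMod 2))) := by
    intro j hv
    rw [hbv (Sum.inr j), hrtwo, hd_of_mem _ hv, hasLocalPoint_iff_of_two_of_dvd (hprime _).1 (h4 _)
      (hδ _) (hβ _) (hi _), lap1_mulVec, if_pos hv, degSub_univ E r hr]
    generalize Sum.inr j = v
    have four : (4 : ZMod 4) = 0 := rfl
    have h1 : sb * n4 v + tb * m4 v + (degP E r 1 v + 3 * degP E r 3 v + 2 * degQ E v)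
          = 2 * (n4 v + (sd * n4 v + td * m4 v + degSub E Vd v)) ↔
        degP13 E r v + m4 v * (tb : ZMod 4) + n4 v * (sb : ZMod 4)
          = 2 * (n4 v + (sd * n4 v + td * m4 v + degSub E Vd v) + degP E r 3 v + degQ E v) := by
      rw [degP13]
      constructor <;> intro h
      · linear_combination h - (degP E r 3 v + degQ E v) * four
      · linear_combination h + (degP E r 3 v + degQ E v) * four
    rw [h1, eq_two_mul_iff]
    generalize ((((degP13 E r v + m4 v * (tb : ZMod 4) + n4 v * (sb : ZMod 4)).val / 2 : ℕ) :
      ZMod 2)) = P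
    rw [degP13]
    simp only [map_add, map_mul, map_natCast]
    refine and_congr ?_ ?_ <;> constructor <;> intro h
    · linear_combination h - (c2 (m4 v) * tb + c2 (n4 v) * sb) * two
    · linear_combination h + (c2 (m4 v) * tb + c2 (n4 v) * sb) * two
    · linear_combination h + (c2 (degP E r 3 v) + c2 (degQ E v) - P) * two
    · linear_combination h - (c2 (degP E r 3 v) + c2 (degQ E v) - P) * two
  have hl : ∀ i, HasLocalPoint b d (Sum.elim p q (Sum.inl i)) ↔ _ := fun i =>
    ⟨fun h => And.intro (fun hv => (hA i hv).1 h) (fun hv => (hB i hv).1 h),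
      fun h => (em (Sum.inl i ∈ Vd)).elim (fun hv => (hB i hv).2 (h.2 hv))
        (fun hv => (hA i hv).2 (h.1 hv))⟩
  have hr' : ∀ j, HasLocalPoint b d (Sum.elim p q (Sum.inr j)) ↔ _ := fun j =>
    ⟨fun h => And.intro (fun hv => ((hD j hv).1 h).1)
      (And.intro (fun hv => (hC j hv).1 h) (fun hv => ((hD j hv).1 h).2)),
      fun h => (em (Sum.inr j ∈ Vd)).elim (fun hv => (hD j hv).2 ⟨h.1 hv, h.2.2 hv⟩)
        (fun hv => (hC j hv).2 (h.2.1 hv))⟩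
  rw [Sum.forall]
  simp only [hl, hr', forall_and, exists_eq_left']
  tauto
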